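/- arXiv:2508.11308 — 3 statements merged into one kernel-verified Lean document; each statement's English description precedes it below -/
import Mathlib

section
/- Let 2 ≤ m ≤ n. For each integer j with 1 ≤ j ≤ ⌊n/m⌋ define the maximally entangled vector Φ_j : Fin m × Fin n → ℂ by Φ_j (i,k) = 1/√m if (k : ℕ) = (i : ℕ) + (j−1)·m and Φ_j (i,k) = 0 otherwise. Let W be a normalized m×n decomposable entanglement witness. Then N(W) = (m − 1)/2 if and only if there exist a unitary A : Matrix (Fin m) (Fin m) ℂ, a unitary B : Matrix (Fin n) (Fin n) ℂ, an integer k with 1 ≤ k ≤ ⌊n/m⌋, and nonnegative reals p₁, …, p_k with ∑_{j=1}^k p_j = 1, such that W = (A ⊗ B) · (∑_{j=1}^k p_j (Φ_j Φ_jᴴ)^Γ) · (A ⊗ B)ᴴ, where A ⊗ B denotes the Kronecker product acting on Fin m × Fin n. -/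
open Matrix ComplexOrder

noncomputable section

/-- The product vector `a ⊗ b`. -/
def prodVec {m n : ℕ} (a : Fin m → ℂ) (b : Fin n → ℂ) : Fin m × Fin n → ℂ :=
  fun p => a p.1 * b p.2

/-- `W` is block-positive: Hermitian, and the quadratic form on every product
vector is real and nonnegative. -/
def BlockPositive {m n : ℕ} (W : Matrix (Fin m × Fin n) (Fin m × Fin n) ℂ) : Prop :=
  W.IsHermitian ∧ ∀ (a : Fin m → ℂ) (b : Fin n → ℂ),
    0 ≤ (star (prodVec a b) ⬝ᵥ W.mulVec (prodVec a b)).re ∧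
    (star (prodVec a b) ⬝ᵥ W.mulVec (prodVec a b)).im = 0

/-- Partial transpose: `M^Γ ((i,k),(j,l)) = M ((j,k),(i,l))`. -/
def ptrans {m n : ℕ} (M : Matrix (Fin m × Fin n) (Fin m × Fin n) ℂ) :
    Matrix (Fin m × Fin n) (Fin m × Fin n) ℂ :=
  fun p q => M (q.1, p.2) (p.1, q.2)

/-- `W` is decomposable: `W = P + Q^Γ` with `P, Q` positive semidefinite. -/
def Decomposable {m n : ℕ} (W : Matrix (Fin m × Fin n) (Fin m × Fin n) ℂ) : Prop :=
  ∃ P Q : Matrix (Fin m × Fin n) (Fin m × Fin n) ℂ,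
    P.PosSemidef ∧ Q.PosSemidef ∧ W = P + ptrans Q

/-- Negativity: absolute value of the sum of the negative eigenvalues. -/
noncomputable def negativity {N : Type*} [Fintype N] [DecidableEq N]
    {W : Matrix N N ℂ} (hW : W.IsHermitian) : ℝ :=
  ∑ i, max (-(hW.eigenvalues i)) 0

/-- The eigenvalues of a Hermitian matrix, listed in non-increasing order with
multiplicity. -/
noncomputable def sortedEigs {N : Type*} [Fintype N] [DecidableEq N]
    {W : Matrix N N ℂ} (hW : W.IsHermitian) : List ℝ :=
  (Finset.univ.val.map hW.eigenvalues).sort (· ≥ ·)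

/-- The vector `e_a ⊗ x_b` with `x_b` the `b`-th row of `φ`. -/
def eVec {m n : ℕ} (φ : Fin m × Fin n → ℂ) (a b : Fin m) : Fin m × Fin n → ℂ :=
  fun p => if p.1 = a then φ (b, p.2) else 0

def rowDot {m n : ℕ} (φ ψ : Fin m × Fin n → ℂ) (b d : Fin m) : ℂ :=
  ∑ k, star (φ (b, k)) * ψ (d, k)

lemma eVec_dot {m n : ℕ} (φ ψ : Fin m × Fin n → ℂ) (a b c d : Fin m) :
    star (eVec φ a b) ⬝ᵥ eVec ψ c d = if a = c then rowDot φ ψ b d else 0 := by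
  simp only [dotProduct, eVec, rowDot, Pi.star_apply, Fintype.sum_prod_type]
  rw [Finset.sum_eq_single a]
  · by_cases h : a = c <;> simp [h]
  · intro x _ hx
    simp [hx]
  · simp

lemma rowDot_sum {m n : ℕ} (φ ψ : Fin m × Fin n → ℂ) :
    ∑ a, rowDot φ ψ a a = star φ ⬝ᵥ ψ := by
  simp [dotProduct, rowDot, Fintype.sum_prod_type]

def sVec {m n : ℕ} (φ : Fin m × Fin n → ℂ) (a b : Fin m) := eVec φ a b + eVec φ b a
def dVec {m n : ℕ} (φ : Fin m × Fin n → ℂ) (a b : Fin m) := eVec φ a b - eVec φ b a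

lemma dVec_sum {m n : ℕ} (φ : Fin m × Fin n → ℂ) :
    ∑ a, ∑ b, star (dVec φ a b) ⬝ᵥ dVec φ a b = 2 * ((m : ℂ) - 1) * (star φ ⬝ᵥ φ) := by
  have h : ∀ a b, star (dVec φ a b) ⬝ᵥ dVec φ a b =
      rowDot φ φ b b + rowDot φ φ a a - (if a = b then rowDot φ φ b a else 0)
        - (if b = a then rowDot φ φ a b else 0) := by
    intro a b
    simp only [dVec, star_sub, sub_dotProduct, dotProduct_sub, eVec_dot, if_true]
    ring
  simp only [h, Finset.sum_sub_distrib, Finset.sum_add_distrib, Finset.sum_const,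
    Finset.sum_ite_eq, Finset.sum_ite_eq', Finset.mem_univ, if_true, rowDot_sum,
    Finset.card_univ, Fintype.card_fin, nsmul_eq_mul, ← Finset.mul_sum]
  ring

lemma trace_ptrans {m n : ℕ} (φ : Fin m × Fin n → ℂ)
    (R : Matrix (Fin m × Fin n) (Fin m × Fin n) ℂ) :
    (ptrans (vecMulVec φ (star φ)) * R).trace =
      ∑ a, ∑ b, star (eVec φ a b) ⬝ᵥ R *ᵥ (eVec φ b a) := by
  have h : ∀ a b, star (eVec φ a b) ⬝ᵥ R *ᵥ (eVec φ b a) =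
      ∑ l, ∑ k, star (φ (b, l)) * (R (a, l) (b, k) * φ (a, k)) := by
    intro a b
    simp only [dotProduct, mulVec, eVec, Pi.star_apply, Fintype.sum_prod_type]
    rw [Finset.sum_eq_single a]
    · refine Finset.sum_congr rfl fun l _ => ?_
      rw [Finset.sum_eq_single b]
      · simp [Finset.mul_sum]
      · intro x _ hx; simp [hx]
      · simp
    · intro x _ hx; simp [hx]
    · simp
  simp only [h, trace, diag, mul_apply, ptrans, vecMulVec_apply, Fintype.sum_prod_type,
    Pi.star_apply]
  have h2 : ∀ i : Fin m, ∑ k : Fin n, ∑ j : Fin m, ∑ l : Fin n,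
      φ (j, k) * star (φ (i, l)) * R (j, l) (i, k) =
      ∑ j : Fin m, ∑ l : Fin n, ∑ k : Fin n, φ (j, k) * star (φ (i, l)) * R (j, l) (i, k) := by
    intro i
    rw [Finset.sum_comm]
    exact Finset.sum_congr rfl fun j _ => Finset.sum_comm
  rw [Finset.sum_congr rfl fun i _ => h2 i, Finset.sum_comm]
  refine Finset.sum_congr rfl fun a _ => Finset.sum_congr rfl fun b _ =>
    Finset.sum_congr rfl fun l _ => Finset.sum_congr rfl fun k _ => ?_
  ring

lemma herm_dot {N : Type*} [Fintype N] {R : Matrix N N ℂ} (hR : R.IsHermitian) (u v : N → ℂ) :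
    star (R *ᵥ u) ⬝ᵥ v = star u ⬝ᵥ R *ᵥ v := by
  rw [star_mulVec, hR.eq, dotProduct_mulVec]

lemma key_identity {m n : ℕ} (φ : Fin m × Fin n → ℂ)
    (R : Matrix (Fin m × Fin n) (Fin m × Fin n) ℂ) (hR : R.IsHermitian) (hRR : R * R = R) :
    ((m : ℂ) - 1) / 2 * (star φ ⬝ᵥ φ) + (ptrans (vecMulVec φ (star φ)) * R).trace =
     (1 / 4) * ∑ a, ∑ b, (star (R *ᵥ sVec φ a b) ⬝ᵥ R *ᵥ sVec φ a b +
      star (dVec φ a b - R *ᵥ dVec φ a b) ⬝ᵥ (dVec φ a b - R *ᵥ dVec φ a b)) := by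
  have h : ∀ a b, (star (R *ᵥ sVec φ a b) ⬝ᵥ R *ᵥ sVec φ a b +
      star (dVec φ a b - R *ᵥ dVec φ a b) ⬝ᵥ (dVec φ a b - R *ᵥ dVec φ a b)) =
      star (dVec φ a b) ⬝ᵥ dVec φ a b + 2 * (star (eVec φ a b) ⬝ᵥ R *ᵥ (eVec φ b a))
        + 2 * (star (eVec φ b a) ⬝ᵥ R *ᵥ (eVec φ a b)) := by
    intro a b
    simp only [star_sub, sub_dotProduct, dotProduct_sub, herm_dot hR, mulVec_mulVec, hRR]
    simp only [sVec, dVec, star_sub, star_add, sub_dotProduct, dotProduct_sub, add_dotProduct,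
      dotProduct_add, mulVec_add, mulVec_sub]
    ring
  simp only [h, Finset.sum_add_distrib, dVec_sum, ← Finset.mul_sum, trace_ptrans]
  rw [Finset.sum_comm (f := fun a b => star (eVec φ b a) ⬝ᵥ R *ᵥ (eVec φ a b))]
  ring

lemma key_nonneg {m n : ℕ} (φ : Fin m × Fin n → ℂ)
    (R : Matrix (Fin m × Fin n) (Fin m × Fin n) ℂ) (hR : R.IsHermitian) (hRR : R * R = R) :
    0 ≤ ((m : ℂ) - 1) / 2 * (star φ ⬝ᵥ φ) + (ptrans (vecMulVec φ (star φ)) * R).trace := by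
  rw [key_identity φ R hR hRR]
  refine mul_nonneg (by positivity) (Finset.sum_nonneg fun a _ => Finset.sum_nonneg fun b _ =>
    add_nonneg (dotProduct_star_self_nonneg _) (dotProduct_star_self_nonneg _))

lemma key_zero {m n : ℕ} (φ : Fin m × Fin n → ℂ)
    (R : Matrix (Fin m × Fin n) (Fin m × Fin n) ℂ) (hR : R.IsHermitian) (hRR : R * R = R)
    (h0 : ((m : ℂ) - 1) / 2 * (star φ ⬝ᵥ φ) + (ptrans (vecMulVec φ (star φ)) * R).trace = 0)
    (a b : Fin m) : R *ᵥ sVec φ a b = 0 ∧ R *ᵥ dVec φ a b = dVec φ a b := by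
  rw [key_identity φ R hR hRR] at h0
  have hnn : ∀ a b, 0 ≤ (star (R *ᵥ sVec φ a b) ⬝ᵥ R *ᵥ sVec φ a b +
      star (dVec φ a b - R *ᵥ dVec φ a b) ⬝ᵥ (dVec φ a b - R *ᵥ dVec φ a b)) := fun a b =>
    add_nonneg (dotProduct_star_self_nonneg _) (dotProduct_star_self_nonneg _)
  have h1 := (mul_eq_zero.1 h0).resolve_left (by norm_num)
  rw [Finset.sum_eq_zero_iff_of_nonneg
    (fun a _ => Finset.sum_nonneg fun b _ => hnn a b)] at h1
  have h2 := h1 a (Finset.mem_univ _)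
  rw [Finset.sum_eq_zero_iff_of_nonneg (fun b _ => hnn a b)] at h2
  have h3 := h2 b (Finset.mem_univ _)
  rw [add_eq_zero_iff_of_nonneg (dotProduct_star_self_nonneg _) (dotProduct_star_self_nonneg _)] at h3
  refine ⟨dotProduct_star_self_eq_zero.1 h3.1, ?_⟩
  exact (sub_eq_zero.1 (dotProduct_star_self_eq_zero.1 h3.2)).symm

lemma row_orth {m n : ℕ} (φ ψ : Fin m × Fin n → ℂ)
    (R : Matrix (Fin m × Fin n) (Fin m × Fin n) ℂ) (hR : R.IsHermitian)
    (h1 : ∀ a b, R *ᵥ sVec φ a b = 0) (h2 : ∀ a b, R *ᵥ dVec ψ a b = dVec ψ a b) (a b : Fin m) :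
    (m : ℂ) * rowDot φ ψ a b = if a = b then star φ ⬝ᵥ ψ else 0 := by
  have h : ∀ a b c d, star (sVec φ a b) ⬝ᵥ dVec ψ c d = 0 := by
    intro a b c d
    rw [← h2, ← herm_dot hR, h1]; simp
  simp only [sVec, dVec, star_add, add_dotProduct, dotProduct_sub, eVec_dot] at h
  have hne : ∀ a b, a ≠ b → rowDot φ ψ a b = 0 := by
    intro a b hab
    have := h a a a b
    simp [hab] at this
    exact this
  have heq : ∀ a b, rowDot φ ψ a a = rowDot φ ψ b b := by
    intro a b
    by_cases hab : a = b
    · rw [hab]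
    have := h a b a b
    simp [hab, Ne.symm hab] at this
    linear_combination -this
  split_ifs with hab
  · subst hab
    rw [← rowDot_sum, Finset.sum_congr rfl (fun b _ => heq b a)]
    simp
  · rw [hne a b hab, mul_zero]

lemma idem_diag {N : Type*} [Fintype N] {R : Matrix N N ℂ} (hR : R.IsHermitian)
    (hRR : R * R = R) (i : N) : 0 ≤ R i i := by
  have h : R.PosSemidef := by
    have := posSemidef_conjTranspose_mul_self R
    rwa [hR.eq, hRR] at this
  exact h.diag_nonneg

lemma spec' {N : Type*} [Fintype N] [DecidableEq N] {W : Matrix N N ℂ} (hW : W.IsHermitian) :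
    W = (hW.eigenvectorUnitary : Matrix N N ℂ) * diagonal (fun i => (hW.eigenvalues i : ℂ)) *
      (hW.eigenvectorUnitary : Matrix N N ℂ)ᴴ := by
  have := hW.spectral_theorem
  rw [Unitary.conjStarAlgAut_apply] at this
  exact this

lemma eigU {N : Type*} [Fintype N] [DecidableEq N] {W : Matrix N N ℂ} (hW : W.IsHermitian) :
    (hW.eigenvectorUnitary : Matrix N N ℂ)ᴴ * (hW.eigenvectorUnitary : Matrix N N ℂ) = 1 ∧
    (hW.eigenvectorUnitary : Matrix N N ℂ) * (hW.eigenvectorUnitary : Matrix N N ℂ)ᴴ = 1 :=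
  ⟨Unitary.coe_star_mul_self hW.eigenvectorUnitary, Unitary.coe_mul_star_self hW.eigenvectorUnitary⟩

lemma conj_idem {N : Type*} [Fintype N] [DecidableEq N] {U R : Matrix N N ℂ} (hU : Uᴴ * U = 1)
    (hR : R.IsHermitian) (hRR : R * R = R) :
    (U * R * Uᴴ).IsHermitian ∧ (U * R * Uᴴ) * (U * R * Uᴴ) = U * R * Uᴴ := by
  constructor
  · exact isHermitian_mul_mul_conjTranspose U hR
  · calc _ = U * R * (Uᴴ * U) * R * Uᴴ := by simp only [Matrix.mul_assoc]
      _ = _ := by rw [hU, Matrix.mul_one, Matrix.mul_assoc U R R, hRR]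

lemma neg_lower {N : Type*} [Fintype N] [DecidableEq N] {W : Matrix N N ℂ} (hW : W.IsHermitian)
    {R : Matrix N N ℂ} (hR : R.IsHermitian) (hRR : R * R = R) :
    -(W * R).trace.re ≤ negativity hW := by
  obtain ⟨hU1, hU2⟩ := eigU hW
  set U := (hW.eigenvectorUnitary : Matrix N N ℂ) with hUdef
  have hc := conj_idem (U := Uᴴ) (by rw [conjTranspose_conjTranspose]; exact hU2) hR hRR
  rw [conjTranspose_conjTranspose] at hc
  have hc' : (1 - Uᴴ * R * U).IsHermitian ∧
      (1 - Uᴴ * R * U) * (1 - Uᴴ * R * U) = 1 - Uᴴ * R * U :=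
    ⟨isHermitian_one.sub hc.1, by rw [sub_mul, mul_sub, mul_sub, hc.2]; simp⟩
  have ht : (W * R).trace = ∑ i, (hW.eigenvalues i : ℂ) * (Uᴴ * R * U) i i := by
    conv_lhs => rw [spec' hW]
    rw [← hUdef, Matrix.mul_assoc, Matrix.mul_assoc, trace_mul_comm, Matrix.mul_assoc]
    simp [trace, diagonal_mul]
  rw [ht, Complex.re_sum, negativity, ← Finset.sum_neg_distrib]
  refine Finset.sum_le_sum fun i _ => ?_
  have h0 := (Complex.le_def.1 (idem_diag hc.1 hc.2 i)).1
  have h1 := (Complex.le_def.1 (idem_diag hc'.1 hc'.2 i)).1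
  simp only [Matrix.sub_apply, one_apply_eq, Complex.sub_re, Complex.one_re, Complex.zero_re] at h0 h1
  rw [Complex.re_ofReal_mul]
  rcases le_total 0 (hW.eigenvalues i) with h | h
  · refine le_trans ?_ (le_max_right _ _)
    nlinarith
  · refine le_trans ?_ (le_max_left _ _)
    nlinarith

lemma neg_attained {N : Type*} [Fintype N] [DecidableEq N] {W : Matrix N N ℂ}
    (hW : W.IsHermitian) : ∃ R : Matrix N N ℂ, R.IsHermitian ∧ R * R = R ∧
      (W * R).trace = -(negativity hW : ℂ) := by
  obtain ⟨hU1, hU2⟩ := eigU hW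
  set U := (hW.eigenvectorUnitary : Matrix N N ℂ) with hUdef
  set D : Matrix N N ℂ := diagonal (fun i => if hW.eigenvalues i < 0 then (1 : ℂ) else 0)
  have hD : D.IsHermitian := by
    refine isHermitian_diagonal_of_self_adjoint _ ?_
    ext i
    simp only [Pi.star_apply]
    split_ifs <;> simp
  have hDD : D * D = D := by
    simp only [D, diagonal_mul_diagonal]
    congr 1
    ext i
    split_ifs <;> simp
  obtain ⟨h1, h2⟩ := conj_idem hU1 hD hDD
  refine ⟨_, h1, h2, ?_⟩
  conv_lhs => rw [spec' hW]
  rw [← hUdef]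
  have : U * diagonal (fun i => (hW.eigenvalues i : ℂ)) * Uᴴ * (U * D * Uᴴ) =
      U * (diagonal (fun i => (hW.eigenvalues i : ℂ)) * D) * Uᴴ := by
    calc _ = U * diagonal (fun i => (hW.eigenvalues i : ℂ)) * (Uᴴ * U) * D * Uᴴ := by
          simp only [Matrix.mul_assoc]
      _ = _ := by rw [hU1]; simp only [Matrix.mul_assoc, Matrix.one_mul]
  rw [this, trace_mul_comm, ← Matrix.mul_assoc, hU1, Matrix.one_mul]
  simp only [D, diagonal_mul_diagonal, trace_diagonal, negativity]
  push_cast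
  rw [← Finset.sum_neg_distrib]
  refine Finset.sum_congr rfl fun i _ => ?_
  split_ifs with h
  · rw [max_eq_left (by linarith)]; simp
  · rw [max_eq_right (by linarith)]; simp

lemma psd_trace {N : Type*} [Fintype N] {P R : Matrix N N ℂ} (hP : P.PosSemidef)
    (hR : R.IsHermitian) (hRR : R * R = R) : 0 ≤ (P * R).trace := by
  have h := (hP.conjTranspose_mul_mul_same R).trace_nonneg
  rw [hR.eq, Matrix.mul_assoc, trace_mul_comm, Matrix.mul_assoc, hRR] at h
  exact h

lemma spec_sum {N : Type*} [Fintype N] [DecidableEq N] {Q : Matrix N N ℂ} (hQ : Q.PosSemidef) :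
    ∃ (q : N → ℝ) (φ : N → N → ℂ), (∀ i, 0 ≤ q i) ∧
      (∀ i j, star (φ i) ⬝ᵥ φ j = if i = j then 1 else 0) ∧
      Q = ∑ i, (q i : ℂ) • vecMulVec (φ i) (star (φ i)) := by
  obtain ⟨hU1, hU2⟩ := eigU hQ.1
  have hs := spec' hQ.1
  set U := (hQ.1.eigenvectorUnitary : Matrix N N ℂ) with hUdef
  refine ⟨hQ.1.eigenvalues, fun i k => U k i, hQ.eigenvalues_nonneg, ?_, ?_⟩
  · intro i j
    have := congrFun (congrFun hU1 i) j
    rw [one_apply] at this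
    rw [← this]
    simp [dotProduct, mul_apply]
  · conv_lhs => rw [hs]
    ext a b
    rw [mul_apply, Matrix.sum_apply]
    refine Finset.sum_congr rfl fun i _ => ?_
    simp only [mul_diagonal, Matrix.smul_apply, vecMulVec_apply, conjTranspose_apply, Pi.star_apply,
      smul_eq_mul]
    ring

lemma ptrans_trace {m n : ℕ} (M : Matrix (Fin m × Fin n) (Fin m × Fin n) ℂ) :
    (ptrans M).trace = M.trace := rfl

lemma ptrans_sum {m n : ℕ} {ι : Type*} (s : Finset ι)
    (c : ι → ℂ) (M : ι → Matrix (Fin m × Fin n) (Fin m × Fin n) ℂ) :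
    ptrans (∑ i ∈ s, c i • M i) = ∑ i ∈ s, c i • ptrans (M i) := by
  ext p q
  simp [ptrans, Matrix.sum_apply]

/-- upper bound together with the equality analysis -/
lemma upper_eq {m n : ℕ} (hm : 2 ≤ m) {W P Q : Matrix (Fin m × Fin n) (Fin m × Fin n) ℂ}
    (hW : W.IsHermitian) (htr : W.trace = 1) (hP : P.PosSemidef) (hPQ : W = P + ptrans Q)
    {ι : Type*} [Fintype ι] (q : ι → ℝ) (φ : ι → Fin m × Fin n → ℂ) (hq : ∀ i, 0 ≤ q i)
    (hφ : ∀ i, star (φ i) ⬝ᵥ φ i = 1)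
    (hQ : Q = ∑ i, (q i : ℂ) • vecMulVec (φ i) (star (φ i))) :
    negativity hW ≤ ((m : ℝ) - 1) / 2 ∧ (negativity hW = ((m : ℝ) - 1) / 2 → P = 0 ∧
      ∃ R : Matrix (Fin m × Fin n) (Fin m × Fin n) ℂ, R.IsHermitian ∧
      ∀ i, 0 < q i → ∀ a b, R *ᵥ sVec (φ i) a b = 0 ∧ R *ᵥ dVec (φ i) a b = dVec (φ i) a b) := by
  obtain ⟨R, hR, hRR, hN⟩ := neg_attained hW
  have hmpos : (0 : ℂ) < ((m : ℂ) - 1) / 2 := by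
    have : (0 : ℝ) < ((m : ℝ) - 1) / 2 := by
      have : (2 : ℝ) ≤ m := by exact_mod_cast hm
      linarith
    have h2 : ((m : ℂ) - 1) / 2 = ((((m : ℝ) - 1) / 2 : ℝ) : ℂ) := by push_cast; rfl
    rw [h2]
    exact Complex.zero_lt_real.2 this
  set G : ι → ℂ := fun i => ((m : ℂ) - 1) / 2 * (star (φ i) ⬝ᵥ φ i) +
    (ptrans (vecMulVec (φ i) (star (φ i))) * R).trace with hG
  have hG0 : ∀ i, 0 ≤ G i := fun i => key_nonneg (φ i) R hR hRR
  have hqc : ∀ i, (0 : ℂ) ≤ q i := fun i => by exact_mod_cast hq i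
  have htrQ : Q.trace = ∑ i, (q i : ℂ) := by
    rw [hQ, trace_sum]
    refine Finset.sum_congr rfl fun i _ => ?_
    rw [trace_smul, trace_vecMulVec, dotProduct_comm, hφ]; simp
  have e1 : ∑ i, (q i : ℂ) * G i = ((m : ℂ) - 1) / 2 * Q.trace + (ptrans Q * R).trace := by
    rw [htrQ, hQ, ptrans_sum, Finset.sum_mul, trace_sum, Finset.mul_sum, ← Finset.sum_add_distrib]
    refine Finset.sum_congr rfl fun i _ => ?_
    rw [hG]
    simp only [hφ, smul_mul, trace_smul, smul_eq_mul]
    ring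
  have key : ((m : ℂ) - 1) / 2 - negativity hW =
      ((m : ℂ) - 1) / 2 * P.trace + (P * R).trace + ∑ i, (q i : ℂ) * G i := by
    rw [e1]
    have h1 : P.trace + Q.trace = 1 := by
      rw [← htr, hPQ, trace_add, ptrans_trace]
    have h2 : (P * R).trace + (ptrans Q * R).trace = -(negativity hW : ℂ) := by
      rw [← hN, hPQ, add_mul, trace_add]
    linear_combination (-((m : ℂ) - 1) / 2) * h1 - h2
  have n1 : 0 ≤ ((m : ℂ) - 1) / 2 * P.trace := mul_nonneg hmpos.le hP.trace_nonneg
  have n2 := psd_trace hP hR hRR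
  have n3 : 0 ≤ ∑ i, (q i : ℂ) * G i := Finset.sum_nonneg fun i _ => mul_nonneg (hqc i) (hG0 i)
  constructor
  · have h : (0 : ℂ) ≤ ((m : ℂ) - 1) / 2 - negativity hW := by
      rw [key]; exact add_nonneg (add_nonneg n1 n2) n3
    have h' : (0 : ℝ) ≤ ((m : ℝ) - 1) / 2 - negativity hW := by exact_mod_cast h
    linarith
  · intro heq
    rw [heq] at key
    push_cast at key
    rw [sub_self] at key
    have k1 := (add_eq_zero_iff_of_nonneg (add_nonneg n1 n2) n3).1 key.symm
    have k2 := (add_eq_zero_iff_of_nonneg n1 n2).1 k1.1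
    refine ⟨hP.trace_eq_zero_iff.1 ((mul_eq_zero.1 k2.1).resolve_left hmpos.ne'), R, hR, ?_⟩
    intro i hi a b
    have k3 := (Finset.sum_eq_zero_iff_of_nonneg
      (fun i _ => mul_nonneg (hqc i) (hG0 i))).1 k1.2 i (Finset.mem_univ _)
    have k4 := (mul_eq_zero.1 k3).resolve_left (by exact_mod_cast hi.ne')
    exact key_zero (φ i) R hR hRR k4 a b

def swapFun {m n : ℕ} (p : Fin m × Fin n) : Fin m × Fin n :=
  if h : (p.2 : ℕ) / m < n / m then
    (⟨(p.2 : ℕ) % m, Nat.mod_lt _ p.1.pos⟩, ⟨(p.1 : ℕ) + m * ((p.2 : ℕ) / m), by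
      have h1 := p.1.isLt
      have h2 : m * ((p.2 : ℕ) / m + 1) ≤ m * (n / m) := Nat.mul_le_mul_left _ h
      have h3 := Nat.mul_div_le n m
      rw [mul_add] at h2
      omega⟩)
  else p

lemma swapFun_swapFun {m n : ℕ} (p : Fin m × Fin n) : swapFun (swapFun p) = p := by
  by_cases h : (p.2 : ℕ) / m < n / m
  · have hm := p.1.pos
    have e : ((p.1 : ℕ) + m * ((p.2 : ℕ) / m)) / m = (p.2 : ℕ) / m := by
      rw [Nat.add_mul_div_left _ _ hm, Nat.div_eq_of_lt p.1.isLt, zero_add]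
    have e1 : ((p.1 : ℕ) + m * ((p.2 : ℕ) / m)) % m = p.1 := by
      rw [Nat.add_mul_mod_self_left, Nat.mod_eq_of_lt p.1.isLt]
    have hs : swapFun p = (⟨(p.2 : ℕ) % m, Nat.mod_lt _ p.1.pos⟩,
      ⟨(p.1 : ℕ) + m * ((p.2 : ℕ) / m), by
        have := (swapFun p).2.isLt
        simpa only [swapFun, h, dif_pos] using this⟩) := by
      simp only [swapFun, h, dif_pos]
    rw [hs, swapFun]
    simp only [e, h, dif_pos, e1, Nat.mod_add_div]
  · simp [swapFun, h]

def swapMat (m n : ℕ) : Matrix (Fin m × Fin n) (Fin m × Fin n) ℂ :=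
  of fun p q => if swapFun p = q then 1 else 0

lemma swapFun_eq_iff {m n : ℕ} (p q : Fin m × Fin n) : swapFun p = q ↔ swapFun q = p :=
  ⟨fun h => by rw [← h, swapFun_swapFun], fun h => by rw [← h, swapFun_swapFun]⟩

lemma swapMat_herm (m n : ℕ) : (swapMat m n).IsHermitian := by
  ext p q
  simp only [swapMat, conjTranspose_apply, of_apply, swapFun_eq_iff q p]
  split_ifs <;> simp

lemma swapMat_sq (m n : ℕ) : swapMat m n * swapMat m n = 1 := by
  ext p q
  simp only [swapMat, mul_apply, one_apply, of_apply, ite_mul, one_mul, zero_mul,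
    Finset.sum_ite_eq, Finset.mem_univ, if_true, swapFun_swapFun]

lemma sum_block {m n : ℕ} (hm : 0 < m) (j : ℕ) (hj : j < n / m) (c : ℂ) :
    ∑ k : Fin n, (if (k : ℕ) / m = j then c else 0) = m * c := by
  have hb : ∀ a : Fin m, (a : ℕ) + m * j < n := by
    intro a
    have h1 := a.isLt
    have h2 : m * (j + 1) ≤ m * (n / m) := Nat.mul_le_mul_left _ hj
    have h3 := Nat.mul_div_le n m
    rw [mul_add] at h2
    omega
  rw [← Finset.sum_filter]
  have : ∑ k ∈ Finset.univ.filter (fun k : Fin n => (k : ℕ) / m = j), c = ∑ a : Fin m, c := by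
    refine Finset.sum_bij' (fun k _ => ⟨(k : ℕ) % m, Nat.mod_lt _ hm⟩)
      (fun a _ => ⟨(a : ℕ) + m * j, hb a⟩) ?_ ?_ ?_ ?_ ?_
    · simp
    · intro a _
      simp [Nat.add_mul_div_left _ _ hm]
    · intro k hk
      simp only [Finset.mem_filter, Finset.mem_univ, true_and] at hk
      ext
      simp only [← hk, Nat.mod_add_div]
    · intro a _
      ext
      simp [Nat.mod_eq_of_lt a.isLt]
    · simp
  rw [this]
  simp

lemma trace_swap {m n : ℕ} (hm : 0 < m) (Φ : Fin m × Fin n → ℂ) (j : ℕ) (hj : j < n / m)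
    (hΦ : Φ = fun p => if (p.2 : ℕ) = (p.1 : ℕ) + j * m then (((Real.sqrt m)⁻¹ : ℝ) : ℂ) else 0) :
    (ptrans (vecMulVec Φ (star Φ)) * swapMat m n).trace = m := by
  have hc : (((Real.sqrt m)⁻¹ : ℝ) : ℂ) * (((Real.sqrt m)⁻¹ : ℝ) : ℂ) = (m : ℂ)⁻¹ := by
    rw [← Complex.ofReal_mul, ← mul_inv, Real.mul_self_sqrt (by positivity)]
    simp
  have h : ∀ p : Fin m × Fin n, (ptrans (vecMulVec Φ (star Φ)) * swapMat m n) p p =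
      if (p.2 : ℕ) / m = j then (m : ℂ)⁻¹ else 0 := by
    intro p
    rw [mul_apply]
    simp only [swapMat, of_apply, swapFun_eq_iff _ p, mul_ite, mul_one, mul_zero,
      Finset.sum_ite_eq, Finset.mem_univ, if_true, ptrans, vecMulVec_apply, Pi.star_apply]
    have hmd := Nat.mod_add_div (p.2 : ℕ) m
    by_cases h : (p.2 : ℕ) / m = j
    · have h' : (p.2 : ℕ) / m < n / m := by omega
      rw [if_pos h, hΦ]
      simp only [swapFun, h', dif_pos]
      rw [h] at hmd
      rw [if_pos (by rw [mul_comm]; exact hmd.symm), if_pos (by rw [h, mul_comm])]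
      rw [← hc]
      congr 1
      simp
    · rw [if_neg h, hΦ]
      simp only
      rw [if_neg, zero_mul]
      intro h2
      apply h
      rw [h2, Nat.add_mul_div_right _ _ hm, Nat.div_eq_of_lt (swapFun p).1.isLt, zero_add]
  simp only [trace, diag, h, Fintype.sum_prod_type, sum_block hm j hj]
  have : (m : ℂ) ≠ 0 := by exact_mod_cast hm.ne'
  simp [this]

open Kronecker in
lemma conj_ptrans {m n : ℕ} (B : Matrix (Fin n) (Fin n) ℂ) (v w : Fin m × Fin n → ℂ)
    (h : ∀ i k, w (i, k) = ∑ l, B k l * v (i, l)) :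
    ((1 : Matrix (Fin m) (Fin m) ℂ) ⊗ₖ B) * ptrans (vecMulVec v (star v)) *
      ((1 : Matrix (Fin m) (Fin m) ℂ) ⊗ₖ B)ᴴ = ptrans (vecMulVec w (star w)) := by
  ext ⟨i, k⟩ ⟨i', k'⟩
  simp only [mul_apply, conjTranspose_apply, kroneckerMap_apply, ptrans, vecMulVec_apply,
    Pi.star_apply, Fintype.sum_prod_type, h, star_sum, star_mul', one_apply]
  rw [Finset.sum_eq_single i']
  · rw [Finset.sum_mul_sum, Finset.sum_comm]
    refine Finset.sum_congr rfl fun l _ => ?_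
    rw [Finset.sum_eq_single i, Finset.sum_mul]
    · refine Finset.sum_congr rfl fun l' _ => ?_
      simp
      ring
    · intro x _ hx; simp [Ne.symm hx]
    · simp
  · intro x _ hx; simp [Ne.symm hx]
  · simp

lemma unitary_ext {m n r : ℕ} (hm : 0 < m) (g : Fin r → Fin m → Fin n → ℂ)
    (hg : ∀ j a j' b, ∑ k, star (g j a k) * g j' b k = if j = j' ∧ a = b then 1 else 0) :
    r ≤ n / m ∧ ∃ B : Matrix (Fin n) (Fin n) ℂ, B * Bᴴ = 1 ∧ Bᴴ * B = 1 ∧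
      ∀ (j : Fin r) (a : Fin m) (l : Fin n), (l : ℕ) = a + j * m → ∀ k, B k l = g j a k := by
  have hin : ∀ x y : EuclideanSpace ℂ (Fin n), inner ℂ x y = ∑ k, star (x k) * y k := by
    intro x y
    rw [PiLp.inner_apply]
    simp [mul_comm]
  have hle : r ≤ n / m := by
    have ho : Orthonormal ℂ (fun p : Fin r × Fin m => (WithLp.toLp 2 (g p.1 p.2) :
        EuclideanSpace ℂ (Fin n))) := by
      rw [orthonormal_iff_ite]
      rintro ⟨j, a⟩ ⟨j', b⟩
      rw [hin]
      simp only [hg, Prod.mk.injEq]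
    have := ho.linearIndependent.fintype_card_le_finrank
    simp only [Fintype.card_prod, Fintype.card_fin, finrank_euclideanSpace] at this
    exact (Nat.le_div_iff_mul_le hm).2 this
  refine ⟨hle, ?_⟩
  set v : Fin n → EuclideanSpace ℂ (Fin n) := fun l =>
    if h : (l : ℕ) / m < r then WithLp.toLp 2 (g ⟨(l : ℕ) / m, h⟩ ⟨(l : ℕ) % m, Nat.mod_lt _ hm⟩)
    else 0 with hv
  have ho : Orthonormal ℂ (({l : Fin n | (l : ℕ) / m < r} : Set (Fin n)).domRestrict v) := by
    rw [orthonormal_iff_ite]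
    rintro ⟨l, hl⟩ ⟨l', hl'⟩
    change (l : ℕ) / m < r at hl
    change (l' : ℕ) / m < r at hl'
    rw [hin]
    simp only [Set.domRestrict_apply, hv, hl, hl', dif_pos, hg, Fin.mk.injEq, Subtype.mk.injEq]
    congr 1
    rw [Fin.ext_iff]
    apply propext
    constructor
    · rintro ⟨h1, h2⟩
      rw [← Nat.mod_add_div (l : ℕ) m, ← Nat.mod_add_div (l' : ℕ) m, h1, h2]
    · intro h
      rw [h]; exact ⟨rfl, rfl⟩
  obtain ⟨b, hb⟩ := ho.exists_orthonormalBasis_extension_of_card_eq (by simp)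
  have h1 : (of fun k l => b l k : Matrix (Fin n) (Fin n) ℂ)ᴴ * (of fun k l => b l k) = 1 := by
    ext i j
    have := orthonormal_iff_ite.1 b.orthonormal i j
    rw [hin] at this
    rw [mul_apply, one_apply, ← this]
    rfl
  refine ⟨of fun k l => b l k, mul_eq_one_comm.1 h1, h1, ?_⟩
  intro j a l hl k
  have e1 : (l : ℕ) / m = j := by
    rw [hl, Nat.add_mul_div_right _ _ hm, Nat.div_eq_of_lt a.isLt, zero_add]
  have e2 : (l : ℕ) % m = a := by
    rw [hl, Nat.add_mul_mod_self_right, Nat.mod_eq_of_lt a.isLt]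
  have h2 : (l : ℕ) / m < r := by rw [e1]; exact j.isLt
  rw [of_apply, hb l h2]
  simp only [hv, e1, e2, Fin.is_lt, dif_pos, Fin.eta]

open Kronecker in
/-- For a normalized `m × n` decomposable entanglement witness, the negativity
equals `(m-1)/2` iff, up to local unitary equivalence, `W` is a convex
combination of the partial transposes of the maximally entangled states
`Φ_1, …, Φ_k`. -/
theorem stmt_13 {m n : ℕ} (hm : 2 ≤ m) (hmn : m ≤ n)
    (Phi : ℕ → Fin m × Fin n → ℂ)
    (hPhi : ∀ j, Phi j = fun p =>
      if (p.2 : ℕ) = (p.1 : ℕ) + (j - 1) * m then (((Real.sqrt m)⁻¹ : ℝ) : ℂ) else 0)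
    (W : Matrix (Fin m × Fin n) (Fin m × Fin n) ℂ)
    (hBP : BlockPositive W) (hNP : ¬ W.PosSemidef) (htr : W.trace = 1)
    (hD : Decomposable W) :
    negativity hBP.1 = ((m : ℝ) - 1) / 2 ↔
      ∃ (A : Matrix (Fin m) (Fin m) ℂ) (B : Matrix (Fin n) (Fin n) ℂ)
        (k : ℕ) (p : Fin k → ℝ),
        A * Aᴴ = 1 ∧ Aᴴ * A = 1 ∧ B * Bᴴ = 1 ∧ Bᴴ * B = 1 ∧
        1 ≤ k ∧ k ≤ n / m ∧ (∀ j, 0 ≤ p j) ∧ (∑ j, p j) = 1 ∧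
        W = (A ⊗ₖ B) *
          (∑ j : Fin k, ((p j : ℂ)) •
            ptrans (Matrix.vecMulVec (Phi ((j : ℕ) + 1)) (star (Phi ((j : ℕ) + 1))))) *
          (A ⊗ₖ B)ᴴ := by
  have hm0 : 0 < m := by omega
  obtain ⟨P, Q, hP, hQ, hPQ⟩ := hD
  obtain ⟨q, φ, hq, hφ, hQs⟩ := spec_sum hQ
  obtain ⟨hup, hupeq⟩ := upper_eq hm hBP.1 htr hP hPQ q φ hq (fun i => by simp [hφ]) hQs
  have hPhi' : ∀ j, Phi (j + 1) = fun p =>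
      if (p.2 : ℕ) = (p.1 : ℕ) + j * m then (((Real.sqrt m)⁻¹ : ℝ) : ℂ) else 0 := by
    intro j
    rw [hPhi]
    simp
  have hs0 : (((Real.sqrt m)⁻¹ : ℝ) : ℂ) * ((Real.sqrt m : ℝ) : ℂ) = 1 := by
    rw [← Complex.ofReal_mul, inv_mul_cancel₀ (by positivity)]
    simp
  have hs1 : ((Real.sqrt m : ℝ) : ℂ) * ((Real.sqrt m : ℝ) : ℂ) = m := by
    rw [← Complex.ofReal_mul, Real.mul_self_sqrt (by positivity)]
    simp
  constructor
  · intro hN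
    obtain ⟨hP0, R, hR, hRsd⟩ := hupeq hN
    have hWQ : W = ptrans Q := by rw [hPQ, hP0, zero_add]
    set ι := {i // 0 < q i} with hι
    set r := Fintype.card ι with hr
    let e : Fin r ≃ ι := (Fintype.equivFin ι).symm
    set ψ : Fin r → Fin m × Fin n → ℂ := fun j => φ (e j).1 with hψ
    have hψψ : ∀ i j, star (ψ i) ⬝ᵥ ψ j = if i = j then 1 else 0 := by
      intro i j
      rw [hψ]
      simp only [hφ]
      congr 1
      rw [← Subtype.ext_iff, e.injective.eq_iff]
    have hQ' : Q = ∑ j : Fin r, (q (e j).1 : ℂ) • vecMulVec (ψ j) (star (ψ j)) := by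
      rw [Equiv.sum_comp e (fun i : ι => (q i.1 : ℂ) • vecMulVec (φ i.1) (star (φ i.1))), hQs]
      rw [← Finset.sum_subtype (p := fun i => 0 < q i) (Finset.univ.filter (fun i => 0 < q i)) (by simp)
        (fun i => (q i : ℂ) • vecMulVec (φ i) (star (φ i))), Finset.sum_filter]
      refine Finset.sum_congr rfl fun i _ => ?_
      split_ifs with h
      · rfl
      · have : q i = 0 := le_antisymm (not_lt.1 h) (hq i)
        simp [this]
    have htrQ : ((∑ j : Fin r, q (e j).1 : ℝ) : ℂ) = 1 := by
      rw [← htr, hWQ, ptrans_trace, hQ', trace_sum]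
      push_cast
      refine Finset.sum_congr rfl fun j _ => ?_
      rw [trace_smul, trace_vecMulVec, dotProduct_comm, hψψ]; simp
    have htrQ' : (∑ j : Fin r, q (e j).1) = 1 := by exact_mod_cast htrQ
    have hrow : ∀ j a j' b, (m : ℂ) * rowDot (ψ j) (ψ j') a b =
        if j = j' ∧ a = b then 1 else 0 := by
      intro j a j' b
      rw [row_orth (ψ j) (ψ j') R hR (fun a b => (hRsd _ (e j).2 a b).1)
        (fun a b => (hRsd _ (e j').2 a b).2), hψψ]
      by_cases h1 : a = b <;> by_cases h2 : j = j' <;> simp [h1, h2]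
    obtain ⟨hrn, B, hB1, hB2, hB⟩ := unitary_ext hm0
      (fun j a k => ((Real.sqrt m : ℝ) : ℂ) * ψ j (a, k)) (by
        intro j a j' b
        rw [← hrow, rowDot, Finset.mul_sum]
        refine Finset.sum_congr rfl fun k _ => ?_
        rw [← hs1]
        simp
        ring)
    refine ⟨1, B, r, fun j => q (e j).1, by simp, by simp, hB1, hB2, ?_, hrn,
      fun j => hq _, htrQ', ?_⟩
    · by_contra h0
      have h0 : r = 0 := by omega
      have : IsEmpty (Fin r) := by rw [h0]; infer_instance
      simp at htrQ'
    · rw [Finset.mul_sum, Finset.sum_mul, hWQ, hQ', ptrans_sum]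
      refine Finset.sum_congr rfl fun j _ => ?_
      rw [Matrix.mul_smul, smul_mul, conj_ptrans B _ (ψ j)]
      intro i k
      rw [hPhi' j]
      have hb : (i : ℕ) + j * m < n := by
        have h1 := i.isLt
        have h2 : ((j : ℕ) + 1) * m ≤ n / m * m := Nat.mul_le_mul_right _ (by omega)
        have h3 := Nat.div_mul_le_self n m
        rw [add_mul] at h2
        omega
      rw [Finset.sum_eq_single ⟨(i : ℕ) + j * m, hb⟩]
      · rw [hB j i _ rfl]
        simp only [if_true]
        linear_combination (-ψ j (i, k)) * hs0
      · intro l _ hl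
        have : ¬ ((l : ℕ) = i + j * m) := fun h => hl (Fin.ext h)
        simp [this]
      · simp
  · rintro ⟨A, B, k, p, hA1, hA2, hB1, hB2, hk1, hkn, hp0, hp1, hWe⟩
    refine le_antisymm hup ?_
    set M := ∑ j : Fin k, ((p j : ℂ)) •
            ptrans (Matrix.vecMulVec (Phi ((j : ℕ) + 1)) (star (Phi ((j : ℕ) + 1)))) with hM
    set U := A ⊗ₖ B with hUdef
    have hU : Uᴴ * U = 1 := by
      rw [hUdef, conjTranspose_kronecker, ← mul_kronecker_mul, hA2, hB2, one_kronecker_one]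
    set R0 : Matrix (Fin m × Fin n) (Fin m × Fin n) ℂ := (1 / 2 : ℂ) • (1 - swapMat m n) with hR0
    have hR0h : R0.IsHermitian := by
      rw [Matrix.IsHermitian, hR0, conjTranspose_smul, conjTranspose_sub, (swapMat_herm m n).eq]
      simp
    have hR0i : R0 * R0 = R0 := by
      rw [hR0, smul_mul, Matrix.mul_smul, sub_mul, mul_sub, mul_sub, swapMat_sq, smul_smul]
      simp only [mul_one, one_mul]
      module
    have hc := conj_idem hU hR0h hR0i
    have hlow := neg_lower hBP.1 hc.1 hc.2
    have htrM : M.trace = 1 := by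
      rw [← htr, hWe, trace_mul_comm, ← Matrix.mul_assoc, hU, Matrix.one_mul]
    have htrMS : (M * swapMat m n).trace = m := by
      rw [hM, Finset.sum_mul, trace_sum]
      have : ∀ j : Fin k, (((p j : ℂ)) • ptrans (Matrix.vecMulVec (Phi ((j : ℕ) + 1))
          (star (Phi ((j : ℕ) + 1)))) * swapMat m n).trace = (p j : ℂ) * m := by
        intro j
        rw [smul_mul, trace_smul, trace_swap hm0 _ j (by omega) (hPhi' j), smul_eq_mul]
      rw [Finset.sum_congr rfl fun j _ => this j, ← Finset.sum_mul, ← Complex.ofReal_sum, hp1]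
      simp
    have ht : (W * (U * R0 * Uᴴ)).trace = (1 / 2 : ℂ) * (1 - m) := by
      have : W * (U * R0 * Uᴴ) = U * (M * R0) * Uᴴ := by
        rw [hWe]
        calc _ = U * M * (Uᴴ * U) * R0 * Uᴴ := by simp only [Matrix.mul_assoc]
          _ = _ := by rw [hU]; simp only [Matrix.mul_assoc, Matrix.one_mul]
      rw [this, trace_mul_comm, ← Matrix.mul_assoc, hU, Matrix.one_mul, hR0, Matrix.mul_smul, trace_smul,
        mul_sub, Matrix.mul_one, trace_sub, htrM, htrMS, smul_eq_mul]
    rw [ht] at hlow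
    have h2 : ((1 / 2 : ℂ) * (1 - m)) = (((1 / 2) * (1 - m) : ℝ) : ℂ) := by push_cast; rfl
    rw [h2, Complex.ofReal_re] at hlow
    linarith

end
end

section
/- Let 3 ≤ m ≤ n and let W be a normalized m×n decomposable entanglement witness with eigenvalues λ_1 ≥ λ_2 ≥ … ≥ λ_{mn} listed in non-increasing order with multiplicity. Then the sum of the two smallest eigenvalues satisfies λ_{mn} + λ_{mn−1} ≥ −√2/2. Moreover, equality is attained: for φ = (√2/2) e₁⊗f₁ + (1/2) e₂⊗f₂ + (1/2) e₃⊗f₃ (e_i, f_i standard basis vectors of ℂ^m and ℂ^n), the matrix W = (φ φᴴ)^Γ is a normalized m×n decomposable entanglement witness whose two smallest eigenvalues sum to −√2/2. -/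
open Matrix ComplexOrder

noncomputable section

lemma kappa_bound {E : Type*} [DecidableEq E] (s : Finset E) (w k : E → ℝ) (C : ℝ)
    (hk0 : ∀ e, 0 ≤ k e) (hk1 : ∀ e, k e ≤ 1)
    (hsum : (∑ e ∈ s, k e = 2) ∨ (∑ e ∈ s, k e ≤ 2 ∧ ∀ e ∈ s, w e ≤ C) )
    (hC : 0 ≤ C ∨ ∑ e ∈ s, k e = 2)
    (hw : ∀ e ∈ s, ∀ f ∈ s, e ≠ f → w e + w f ≤ C) :
    ∑ e ∈ s, k e * w e ≤ C := by
  by_cases h : ∀ e ∈ s, w e ≤ C / 2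
  · have h1 : ∑ e ∈ s, k e * w e ≤ ∑ e ∈ s, k e * (C / 2) :=
      Finset.sum_le_sum fun e he => mul_le_mul_of_nonneg_left (h e he) (hk0 e)
    rw [← Finset.sum_mul] at h1
    rcases hC with hC | hC
    · have : ∑ e ∈ s, k e ≤ 2 := by rcases hsum with h | h; exacts [h.le, h.1]
      nlinarith
    · rw [hC] at h1; linarith
  · push Not at h
    obtain ⟨e, he, hwe⟩ := h
    have h1 : ∑ f ∈ s.erase e, k f * w f ≤ ∑ f ∈ s.erase e, k f * (C - w e) :=
      Finset.sum_le_sum fun f hf => by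
        apply mul_le_mul_of_nonneg_left _ (hk0 f)
        have := hw e he f (Finset.mem_of_mem_erase hf) (Finset.ne_of_mem_erase hf).symm
        linarith
    rw [← Finset.sum_mul] at h1
    rw [← Finset.add_sum_erase s _ he] at hsum ⊢
    have h2 := hk1 e
    rcases hsum with h | ⟨h, h'⟩
    · have : ∑ f ∈ s.erase e, k f = 2 - k e := by linarith
      rw [this] at h1
      nlinarith
    · have := h' e he
      have : (∑ f ∈ s.erase e, k f) * (C - w e) ≤ (2 - k e) * (C - w e) := by
        apply mul_le_mul_of_nonneg_right <;> linarith
      nlinarith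

lemma sort_drop {N : Type*} [Fintype N] [DecidableEq N] (f : N → ℝ) (h2 : 2 ≤ Fintype.card N) :
    ∃ p q : N, p ≠ q ∧
      (((Finset.univ.val.map f).sort (· ≥ ·)).drop (Fintype.card N - 2)).sum = f p + f q ∧
      ∀ i j, i ≠ j → f p + f q ≤ f i + f j := by
  have hne : (Finset.univ : Finset N).Nonempty := by
    rw [← Finset.card_pos, Finset.card_univ]; omega
  obtain ⟨p, -, hp⟩ := Finset.exists_min_image Finset.univ f hne
  have hne2 : ((Finset.univ : Finset N).erase p).Nonempty := by
    rw [← Finset.card_pos, Finset.card_erase_of_mem (Finset.mem_univ _), Finset.card_univ]; omega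
  obtain ⟨q, hqm, hq⟩ := Finset.exists_min_image _ f hne2
  have hqp : q ≠ p := Finset.ne_of_mem_erase hqm
  refine ⟨p, q, hqp.symm, ?_, ?_⟩
  · set r := (Finset.univ.erase p).erase q with hr
    have hmul : (Finset.univ : Finset N).val = p ::ₘ q ::ₘ r.val := by
      rw [← Finset.insert_erase (Finset.mem_univ p), Finset.insert_val_of_notMem (by simp),
        ← Finset.insert_erase hqm, Finset.insert_val_of_notMem (by simp)]
    have hcard : r.card = Fintype.card N - 2 := by
      rw [hr, Finset.card_erase_of_mem hqm, Finset.card_erase_of_mem (Finset.mem_univ _),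
        Finset.card_univ]; omega
    have hsort : (Finset.univ.val.map f).sort (· ≥ ·) =
        (r.val.map f).sort (· ≥ ·) ++ [f q, f p] := by
      apply List.Perm.eq_of_pairwise (le := (· ≥ ·))
      · intro a b _ _ h1 h2; exact le_antisymm h2 h1
      · exact Multiset.pairwise_sort _ _
      · rw [List.pairwise_append]
        refine ⟨Multiset.pairwise_sort _ _, ?_, ?_⟩
        · simp [hp q]
        · intro a ha b hb
          simp only [Multiset.mem_sort, Multiset.mem_map] at ha
          obtain ⟨x, hx, rfl⟩ := ha
          simp only [List.mem_cons, List.not_mem_nil, or_false] at hb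
          rcases hb with rfl | rfl
          · exact hq x (Finset.mem_of_mem_erase hx)
          · exact hp x (Finset.mem_univ _)
      · rw [← Multiset.coe_eq_coe, Multiset.sort_eq, ← Multiset.coe_add, Multiset.sort_eq, hmul]
        simp only [Multiset.map_cons]
        rw [add_comm]
        rw [← Multiset.cons_coe, ← Multiset.cons_coe, Multiset.cons_swap]
        simp
    rw [hsort, List.drop_left' (by simp [hcard])]
    simp [add_comm]
  · intro i j hij
    by_cases hi : i = p
    · subst hi
      have := hq j (by simp [hij.symm])
      linarith
    · have := hq i (by simp [hi])
      have := hp j (Finset.mem_univ _)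
      linarith

lemma edge_bound {I : Type*} [Fintype I] [LinearOrder I] (a : I → ℝ)
    (e f : {p : I × I // p.1 < p.2}) (hef : e ≠ f) :
    a e.1.1 * a e.1.2 + a f.1.1 * a f.1.2 ≤ Real.sqrt 2 / 2 * ∑ i, a i ^ 2 := by
  have hs : Real.sqrt 2 ^ 2 = 2 := Real.sq_sqrt (by norm_num)
  have hs1 : 1 ≤ Real.sqrt 2 := by
    rw [show (1:ℝ) = Real.sqrt 1 by simp]; exact Real.sqrt_le_sqrt (by norm_num)
  have key3 : ∀ x y z : I, x ≠ y → x ≠ z → y ≠ z →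
      a x * a y + a x * a z ≤ Real.sqrt 2 / 2 * ∑ i, a i ^ 2 := by
    intro x y z hxy hxz hyz
    have h1 : ∑ i ∈ {x, y, z}, a i ^ 2 ≤ ∑ i, a i ^ 2 :=
      Finset.sum_le_univ_sum_of_nonneg fun i => sq_nonneg _
    rw [Finset.sum_insert (by simp [hxy, hxz]), Finset.sum_insert (by simp [hyz]),
      Finset.sum_singleton] at h1
    have h2 : Real.sqrt 2 / 2 * (a x ^ 2 + (a y ^ 2 + a z ^ 2)) ≤ Real.sqrt 2 / 2 * ∑ i, a i ^ 2 :=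
      mul_le_mul_of_nonneg_left h1 (by positivity)
    refine le_trans ?_ h2
    set s := Real.sqrt 2
    have e1 : s / 2 * (a x ^ 2 + (a y ^ 2 + a z ^ 2)) - (a x * a y + a x * a z)
      = s / 4 * ((a x - s * a y)^2 + (a x - s * a z)^2)
        + (s/2 - s * s^2/4) * (a y ^ 2 + a z ^ 2) + (s^2/2-1) * (a x * a y + a x * a z):= by ring
    rw [hs] at e1
    have : 0 ≤ s / 4 * ((a x - s * a y)^2 + (a x - s * a z)^2) := by positivity
    nlinarith
  obtain ⟨⟨i, j⟩, hij⟩ := e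
  obtain ⟨⟨k, l⟩, hkl⟩ := f
  simp only at hij hkl ⊢
  have hne : ¬ (i = k ∧ j = l) := by
    rintro ⟨rfl, rfl⟩; exact hef rfl
  by_cases h1 : i = k
  · subst h1
    exact key3 i j l hij.ne hkl.ne (fun h => hne ⟨rfl, h⟩)
  by_cases h2 : j = l
  · subst h2
    have := key3 j i k hij.ne' hkl.ne' h1
    linarith
  by_cases h3 : i = l
  · subst h3
    have := key3 i j k hij.ne hkl.ne' (by rintro rfl; exact lt_asymm hij hkl)
    linarith
  by_cases h4 : j = k
  · subst h4
    have := key3 j i l hij.ne' hkl.ne h3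
    linarith
  have h5 : ∑ x ∈ {i, j, k, l}, a x ^ 2 ≤ ∑ x, a x ^ 2 :=
    Finset.sum_le_univ_sum_of_nonneg fun i => sq_nonneg _
  rw [Finset.sum_insert (by simp [h1, h3, hij.ne]), Finset.sum_insert (by simp [h2, h4]),
    Finset.sum_insert (by simp [hkl.ne]), Finset.sum_singleton] at h5
  nlinarith [sq_nonneg (a i - a j), sq_nonneg (a k - a l), sq_nonneg (a i), sq_nonneg (a j), sq_nonneg (a k), sq_nonneg (a l)]

lemma bessel2 {E : Type*} [NormedAddCommGroup E] [InnerProductSpace ℂ E] (g X Y : E)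
    (hg : ‖g‖ = 1) (hX : ‖X‖ = 1) (hY : ‖Y‖ = 1) (hXY : inner ℂ X Y = 0) :
    ‖inner ℂ g X‖ ^ 2 + ‖inner ℂ g Y‖ ^ 2 ≤ 1 := by
  have ho : Orthonormal ℂ ![X, Y] := by
    constructor
    · intro i; fin_cases i <;> simp [hX, hY]
    · intro i j hij
      have : inner ℂ Y X = 0 := by rw [← inner_conj_symm, hXY]; simp
      fin_cases i <;> fin_cases j <;> simp_all
  have := ho.sum_inner_products_le g (s := Finset.univ)
  simp only [Fin.sum_univ_two, hg] at this
  rw [norm_inner_symm g X, norm_inner_symm g Y]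
  simpa using this

lemma core {E I : Type*} [NormedAddCommGroup E] [InnerProductSpace ℂ E] [Fintype I]
    [LinearOrder I] (g : I × I → E) (hg : Orthonormal ℂ g) (a : I → ℝ) (ha : ∀ i, 0 ≤ a i)
    (X Y : E) (hX : ‖X‖ = 1) (hY : ‖Y‖ = 1) (hXY : inner ℂ X Y = 0) :
    -(Real.sqrt 2 / 2 * ∑ i, a i ^ 2) ≤
      ∑ p : I × I, a p.1 * a p.2 * (inner ℂ (g (p.2, p.1)) X * star (inner ℂ (g p) X)).re +
      ∑ p : I × I, a p.1 * a p.2 * (inner ℂ (g (p.2, p.1)) Y * star (inner ℂ (g p) Y)).re := by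
  let k : {p : I × I // p.1 < p.2} → E := fun p =>
    ((Real.sqrt 2 / 2 : ℝ) : ℂ) • (g p.1 - g (p.1.2, p.1.1))
  have hsC : ((Real.sqrt 2 : ℝ) : ℂ) * ((Real.sqrt 2 : ℝ) : ℂ) = 2 := by
    rw [← Complex.ofReal_mul, Real.mul_self_sqrt (by norm_num)]; simp
  have hk : Orthonormal ℂ k := by
    rw [orthonormal_iff_ite] at hg ⊢
    rintro ⟨⟨i, j⟩, hij⟩ ⟨⟨i', j'⟩, hij'⟩
    simp only at hij hij'
    simp only [k, inner_smul_left, inner_smul_right, inner_sub_left, inner_sub_right, hg,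
      Prod.mk.injEq, Subtype.mk.injEq, Complex.conj_ofReal]
    have n1 : ¬ (i = j' ∧ j = i') := by rintro ⟨rfl, rfl⟩; exact lt_asymm hij hij'
    have n2 : ¬ (j = i' ∧ i = j') := by rintro ⟨rfl, rfl⟩; exact lt_asymm hij hij'
    rw [if_neg n1, if_neg n2]
    by_cases h : i = i' ∧ j = j'
    · rw [if_pos h, if_pos h.symm]
      push_cast
      linear_combination (1/2) * hsC
    · rw [if_neg h, if_neg (fun h' => h h'.symm)]
      simp
  have hdiag : ∀ (Z : E) (i : I), 0 ≤ a i * a i * (inner ℂ (g (i,i)) Z * star (inner ℂ (g (i,i)) Z)).re := by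
    intro Z i
    apply mul_nonneg (mul_nonneg (ha i) (ha i))
    rw [Complex.star_def, Complex.mul_conj]
    simpa using Complex.normSq_nonneg _
  have hquad : ∀ Z : E, -(∑ p : {p : I × I // p.1 < p.2}, ‖inner ℂ (k p) Z‖ ^ 2 * (a p.1.1 * a p.1.2)) ≤
      ∑ p : I × I, a p.1 * a p.2 * (inner ℂ (g (p.2, p.1)) Z * star (inner ℂ (g p) Z)).re := by
    intro Z
    set F : I × I → ℝ := fun p => a p.1 * a p.2 * (inner ℂ (g (p.2, p.1)) Z * star (inner ℂ (g p) Z)).re with hF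
    have hFs : ∀ p : I × I, F p = F p.swap := by
      intro p
      simp only [hF, Prod.swap]
      rw [mul_comm (a p.2)]
      congr 1
      simp only [Complex.mul_re, Complex.star_def, Complex.conj_re, Complex.conj_im]; ring
    have hsplit : ∑ p, F p = ∑ i, F (i, i) + 2 * ∑ p : {p : I × I // p.1 < p.2}, F p.1 := by
      have e1 : ∑ p, F p = ∑ p with p.1 < p.2, F p + ∑ p with ¬ (p.1 < p.2), F p :=
        (Finset.sum_filter_add_sum_filter_not _ _ _).symm
      have e2 : ∑ p with ¬ (p.1 < p.2), F p =
          ∑ p with (¬ (p.1 < p.2)) ∧ p.2 < p.1, F p + ∑ p with (¬ (p.1 < p.2)) ∧ ¬ p.2 < p.1, F p := by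
        rw [← Finset.filter_filter, ← Finset.filter_filter]
        exact (Finset.sum_filter_add_sum_filter_not _ _ _).symm
      have e3 : ∑ p with (¬ (p.1 < p.2)) ∧ p.2 < p.1, F p = ∑ p with p.1 < p.2, F p := by
        apply Finset.sum_nbij' Prod.swap Prod.swap
        · intro p hp; simp at hp ⊢; exact hp.2
        · intro p hp; simp at hp ⊢; exact ⟨hp.le, hp⟩
        · simp
        · simp
        · intro p _; exact hFs p
      have e4 : ∑ p with (¬ (p.1 < p.2)) ∧ ¬ p.2 < p.1, F p = ∑ i, F (i, i) := by
        apply Finset.sum_nbij' Prod.fst (fun i => (i, i))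
        · simp
        · simp
        · rintro ⟨i, j⟩ hp; simp at hp; simp [le_antisymm hp.1 hp.2]
        · simp
        · rintro ⟨i, j⟩ hp; simp at hp; simp [le_antisymm hp.1 hp.2]
      have e5 : ∑ p with p.1 < p.2, F p = ∑ p : {p : I × I // p.1 < p.2}, F p.1 :=
        Finset.sum_subtype _ (by simp) _
      rw [e1, e2, e3, e4, e5]; ring
    rw [hsplit]
    have hd : 0 ≤ ∑ i, F (i, i) := Finset.sum_nonneg fun i _ => hdiag Z i
    rw [← Finset.sum_neg_distrib, Finset.mul_sum]
    refine le_trans ?_ (le_add_of_nonneg_left hd)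
    apply Finset.sum_le_sum
    rintro ⟨⟨i, j⟩, hij⟩ _
    simp only [hF, k, inner_smul_left, inner_sub_left, Complex.conj_ofReal]
    rw [norm_mul, mul_pow, Complex.norm_real, Real.norm_eq_abs, sq_abs, div_pow,
      Real.sq_sqrt (by norm_num), Complex.sq_norm, Complex.normSq_apply]
    set z := inner ℂ (g (i, j)) Z
    set y := inner ℂ (g (j, i)) Z
    have h0 : 0 ≤ a i * a j := mul_nonneg (ha i) (ha j)
    have : 0 ≤ a i * a j * ((z.re + y.re)^2 + (z.im + y.im)^2) := by positivity
    simp [Complex.mul_re]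
    nlinarith
  have hb := kappa_bound (Finset.univ : Finset {p : I × I // p.1 < p.2})
    (fun p => a p.1.1 * a p.1.2)
    (fun p => ‖inner ℂ (k p) X‖ ^ 2 + ‖inner ℂ (k p) Y‖ ^ 2) (Real.sqrt 2 / 2 * ∑ i, a i ^ 2)
    (fun e => by positivity) (fun e => bessel2 _ _ _ (hk.1 e) hX hY hXY)
    (Or.inr ⟨by
      rw [Finset.sum_add_distrib]
      have h1 := hk.sum_inner_products_le X (s := Finset.univ)
      have h2 := hk.sum_inner_products_le Y (s := Finset.univ)
      rw [hX] at h1; rw [hY] at h2; linarith, by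
      rintro ⟨⟨i, j⟩, hij⟩ _
      have h1 : ∑ x ∈ {i, j}, a x ^ 2 ≤ ∑ x, a x ^ 2 :=
        Finset.sum_le_univ_sum_of_nonneg fun i => sq_nonneg _
      rw [Finset.sum_pair hij.ne] at h1
      have hs1 : 1 ≤ Real.sqrt 2 := by
        rw [show (1:ℝ) = Real.sqrt 1 by simp]; exact Real.sqrt_le_sqrt (by norm_num)
      simp only
      nlinarith [sq_nonneg (a i - a j), sq_nonneg (a i), sq_nonneg (a j)]⟩)
    (Or.inl (by positivity))
    (fun e _ f _ hef => edge_bound a e f hef)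
  simp only [add_mul, Finset.sum_add_distrib] at hb
  have := hquad X
  have := hquad Y
  linarith

lemma sum_sub {I M : Type*} [Fintype I] [AddCommMonoid M] (P : I → Prop) [DecidablePred P] (F : I → M)
    (h : ∀ i, ¬ P i → F i = 0) : ∑ i, F i = ∑ i : {i // P i}, F i.1 := by
  rw [← Finset.sum_subtype (Finset.univ.filter P) (by simp) F]
  refine (Finset.sum_subset (Finset.subset_univ _) ?_).symm
  intro i _ hi
  exact h i (by simpa using hi)

lemma svd_aux {m n : ℕ} (A : Matrix (Fin m) (Fin n) ℂ) :
    ∃ (U : Matrix (Fin m) (Fin m) ℂ) (R : Matrix (Fin m) (Fin n) ℂ) (l : Fin m → ℝ),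
      Uᴴ * U = 1 ∧ A = U * R ∧ R * Rᴴ = diagonal (fun i => (l i : ℂ)) := by
  have hH : (A * Aᴴ).IsHermitian := isHermitian_mul_conjTranspose_self A
  have hsp := hH.spectral_theorem
  rw [Unitary.conjStarAlgAut_apply] at hsp
  set U : Matrix (Fin m) (Fin m) ℂ := (hH.eigenvectorUnitary).1 with hU
  have h1 : Uᴴ * U = 1 := Unitary.coe_star_mul_self hH.eigenvectorUnitary
  have h2 : U * Uᴴ = 1 := mul_eq_one_comm.mp h1
  refine ⟨U, Uᴴ * A, hH.eigenvalues, h1, ?_, ?_⟩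
  · rw [← Matrix.mul_assoc, h2, Matrix.one_mul]
  · have h3 : A * Aᴴ = U * diagonal (RCLike.ofReal ∘ hH.eigenvalues) * Uᴴ := hsp
    calc Uᴴ * A * (Uᴴ * A)ᴴ = Uᴴ * (A * Aᴴ) * U := by
          simp [Matrix.conjTranspose_mul, Matrix.mul_assoc]
      _ = (Uᴴ * U) * diagonal (RCLike.ofReal ∘ hH.eigenvalues) * (Uᴴ * U) := by
          refine (congrArg (fun T => Uᴴ * T * U) h3).trans ?_
          simp only [Matrix.mul_assoc]
      _ = _ := by rw [h1, Matrix.one_mul, Matrix.mul_one]; rfl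

lemma qf_expand {m n : ℕ} (ψ x : Fin m × Fin n → ℂ) (U : Matrix (Fin m) (Fin m) ℂ)
    (R : Matrix (Fin m) (Fin n) ℂ) (hA : (Matrix.of fun i k => ψ (i, k)) = U * R) :
    star x ⬝ᵥ (ptrans (vecMulVec ψ (star ψ))).mulVec x =
      ∑ p, ∑ q, (∑ j, ∑ l, star (R q l) * U j p * x (j, l)) *
        star (∑ j, ∑ l, star (R p l) * U j q * x (j, l)) := by
  let A : Matrix (Fin m) (Fin n) ℂ := Matrix.of fun i k => ψ (i, k)
  let X : Matrix (Fin m) (Fin n) ℂ := Matrix.of fun i k => x (i, k)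
  let Z : Matrix (Fin m) (Fin m) ℂ := R.map star * Xᵀ * U
  have hZ : ∀ q p, Z q p = ∑ j, ∑ l, star (R q l) * U j p * x (j, l) := by
    intro q p
    simp only [Z, X, Matrix.mul_apply, Matrix.map_apply, Matrix.transpose_apply, Matrix.of_apply,
      Finset.sum_mul]
    refine Finset.sum_congr rfl fun j _ => Finset.sum_congr rfl fun l _ => by ring
  have h1 : star x ⬝ᵥ (ptrans (vecMulVec ψ (star ψ))).mulVec x = (A.map star * Xᵀ * (A * Xᴴ)).trace := by
    simp only [dotProduct, mulVec, ptrans, vecMulVec_apply, Pi.star_apply, Matrix.trace,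
      Matrix.diag_apply, Matrix.mul_apply, Fintype.sum_prod_type, A, X, Matrix.map_apply,
      Matrix.transpose_apply, Matrix.conjTranspose_apply, Matrix.of_apply, Finset.mul_sum,
      Finset.sum_mul]
    refine Finset.sum_congr rfl fun i _ => ?_
    rw [Finset.sum_comm]
    refine Finset.sum_congr rfl fun j _ => ?_
    refine Finset.sum_congr rfl fun k _ => Finset.sum_congr rfl fun l _ => by ring
  have hA' : A = U * R := hA
  have hstar : ∀ {a b c : ℕ} (P : Matrix (Fin a) (Fin b) ℂ) (Q : Matrix (Fin b) (Fin c) ℂ),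
      (P * Q).map star = P.map star * Q.map star := by
    intro a b c P Q
    ext i j
    simp [Matrix.mul_apply]
  have h2 : (A.map star * Xᵀ * (A * Xᴴ)).trace = (Z * Z.map star).trace := by
    have hXX : (Xᵀ).map star = Xᴴ := rfl
    have hRR : (R.map star).map star = R := by ext; simp
    simp only [Z, hstar, hXX, hRR, hA']
    rw [Matrix.mul_assoc (U.map star), Matrix.mul_assoc (U.map star), Matrix.trace_mul_comm (U.map star)]
    simp only [Matrix.mul_assoc]
  rw [h1, h2, ]
  simp only [Matrix.trace, Matrix.diag_apply, Matrix.mul_apply (M := Z), Matrix.map_apply]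
  rw [Finset.sum_comm]
  simp only [hZ]

lemma svd_form {m n : ℕ} (ψ : Fin m × Fin n → ℂ) (X Y : EuclideanSpace ℂ (Fin m × Fin n))
    (hX : ‖X‖ = 1) (hY : ‖Y‖ = 1) (hXY : inner ℂ X Y = 0) :
    -(Real.sqrt 2 / 2 * ∑ p, ‖ψ p‖ ^ 2) ≤
      (star X.ofLp ⬝ᵥ (ptrans (vecMulVec ψ (star ψ))).mulVec X.ofLp).re +
      (star Y.ofLp ⬝ᵥ (ptrans (vecMulVec ψ (star ψ))).mulVec Y.ofLp).re := by
  obtain ⟨U, R, l, hU, hA, hR⟩ := svd_aux (Matrix.of fun i k => ψ (i, k))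
  have hl : ∀ i, l i = ∑ k, ‖R i k‖ ^ 2 := by
    intro i
    have := congrFun (congrFun hR i) i
    simp only [Matrix.mul_apply, conjTranspose_apply, diagonal_apply_eq, Complex.star_def,
      Complex.mul_conj, Complex.normSq_eq_norm_sq] at this
    exact_mod_cast this.symm
  have hl0 : ∀ i, 0 ≤ l i := fun i => by rw [hl]; positivity
  have hR0 : ∀ i, ¬ 0 < l i → ∀ k, R i k = 0 := by
    intro i hi k
    have h0 : l i = 0 := le_antisymm (not_lt.mp hi) (hl0 i)
    rw [hl, Finset.sum_eq_zero_iff_of_nonneg (fun _ _ => by positivity)] at h0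
    simpa using h0 k (Finset.mem_univ _)
  let a : {i // 0 < l i} → ℝ := fun i => Real.sqrt (l i)
  have ha : ∀ i, 0 < a i := fun i => Real.sqrt_pos.mpr i.2
  have ha2 : ∀ i, a i ^ 2 = l i := fun i => Real.sq_sqrt i.2.le
  have haC : ∀ i, (a i : ℂ) ≠ 0 := fun i => by exact_mod_cast (ha i).ne'
  have hsum : ∑ i, a i ^ 2 = ∑ p, ‖ψ p‖ ^ 2 := by
    simp only [ha2]
    rw [← sum_sub (fun i => 0 < l i) l (fun i hi => le_antisymm (not_lt.mp hi) (hl0 i))]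
    have h1 : (R * Rᴴ).trace = ((Matrix.of fun i k => ψ (i, k)) * (Matrix.of fun i k => ψ (i, k))ᴴ).trace := by
      rw [hA, conjTranspose_mul, Matrix.mul_assoc U, Matrix.trace_mul_comm U]
      rw [Matrix.mul_assoc, Matrix.mul_assoc, hU, Matrix.mul_one]
    rw [hR] at h1
    simp only [Matrix.trace, diag_apply, diagonal_apply_eq, Matrix.mul_apply, conjTranspose_apply,
      of_apply, Complex.star_def, Complex.mul_conj, Complex.normSq_eq_norm_sq] at h1
    rw [Fintype.sum_prod_type]
    exact_mod_cast h1
  let g : {i // 0 < l i} × {i // 0 < l i} → EuclideanSpace ℂ (Fin m × Fin n) := fun qp =>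
    WithLp.toLp 2 fun jl => star (U jl.1 qp.2) * (R qp.1 jl.2 / a qp.1)
  have hg : Orthonormal ℂ g := by
    rw [orthonormal_iff_ite]
    rintro ⟨q, p⟩ ⟨q', p'⟩
    have h1 : inner ℂ (g (q, p)) (g (q', p')) =
        (Uᴴ * U) p' p * ((R * Rᴴ) q' q / (a q * a q')) := by
      simp only [PiLp.inner_apply, g, Matrix.mul_apply, Fintype.sum_prod_type, conjTranspose_apply,
        RCLike.inner_apply, Finset.sum_div, Finset.sum_mul_sum, map_mul, Complex.star_def, Complex.conj_conj, map_div₀, Complex.conj_ofReal]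
      refine Finset.sum_congr rfl fun j _ => Finset.sum_congr rfl fun k _ => by
        have := haC q; have := haC q'; field_simp
    rw [h1, hU, hR, Matrix.one_apply, Matrix.diagonal_apply]
    by_cases hp : p = p'
    · by_cases hq : q = q'
      · subst hp hq
        have : (l q : ℂ) = a q * a q := by rw [← ha2]; push_cast; ring
        rw [if_pos rfl, if_pos rfl, if_pos rfl, this, one_mul, div_self]
        exact mul_ne_zero (haC q) (haC q)
      · have h3 : ¬ (q'.1 = q.1) := fun h => hq (Subtype.ext h.symm)
        have h4 : ¬ ((q, p) = (q', p')) := fun h => hq (Prod.ext_iff.mp h).1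
        rw [if_neg h4, if_neg h3]; simp
    · have h3 : ¬ (p'.1 = p.1) := fun h => hp (Subtype.ext h.symm)
      have h4 : ¬ ((q, p) = (q', p')) := fun h => hp (Prod.ext_iff.mp h).2
      rw [if_neg h4, if_neg h3]; simp
  have hz : ∀ (x : EuclideanSpace ℂ (Fin m × Fin n)) (q p : {i // 0 < l i}),
      ∑ j, ∑ k, star (R q k) * U j p * x.ofLp (j, k) = a q * inner ℂ (g (q, p)) x := by
    intro x q p
    simp only [PiLp.inner_apply, g, Fintype.sum_prod_type,
        RCLike.inner_apply, Finset.mul_sum, map_mul, Complex.star_def, Complex.conj_conj, map_div₀, Complex.conj_ofReal]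
    refine Finset.sum_congr rfl fun j _ => Finset.sum_congr rfl fun k _ => by
        have := haC q; field_simp
  have hq : ∀ x : EuclideanSpace ℂ (Fin m × Fin n),
      (star x.ofLp ⬝ᵥ (ptrans (vecMulVec ψ (star ψ))).mulVec x.ofLp).re =
      ∑ p : {i // 0 < l i} × {i // 0 < l i}, a p.1 * a p.2 *
        (inner ℂ (g (p.2, p.1)) x * star (inner ℂ (g p) x)).re := by
    intro x
    rw [qf_expand ψ x.ofLp U R hA, sum_sub (fun i => 0 < l i), Fintype.sum_prod_type, Complex.re_sum]
    · refine Finset.sum_congr rfl fun p _ => ?_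
      rw [sum_sub (fun i => 0 < l i), Complex.re_sum]
      · refine Finset.sum_congr rfl fun q _ => ?_
        rw [hz, hz]
        simp only [Complex.star_def, map_mul, Complex.conj_ofReal]
        rw [← Complex.re_ofReal_mul]
        congr 1
        push_cast
        ring
      · intro i hi
        simp [hR0 i hi]
    · intro i hi
      simp [hR0 i hi]
  rw [hq, hq, ← hsum]
  exact core g hg a (fun i => (ha i).le) X Y hX hY hXY

lemma psd_factor {N : Type*} [Fintype N] [DecidableEq N] {Q : Matrix N N ℂ} (hQ : Q.PosSemidef) :
    ∃ ψ : N → N → ℂ, Q = ∑ r, vecMulVec (ψ r) (star (ψ r)) := by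
  have hsp := hQ.1.spectral_theorem
  rw [Unitary.conjStarAlgAut_apply] at hsp
  refine ⟨fun r p => Real.sqrt (hQ.1.eigenvalues r) * (hQ.1.eigenvectorUnitary : Matrix N N ℂ) p r, ?_⟩
  ext p q
  have := congrFun (congrFun hsp p) q
  rw [this, Matrix.sum_apply, Matrix.mul_apply]
  refine Finset.sum_congr rfl fun r _ => ?_
  have h : ((Real.sqrt (hQ.1.eigenvalues r) : ℝ) : ℂ) * ((Real.sqrt (hQ.1.eigenvalues r) : ℝ) : ℂ) = hQ.1.eigenvalues r := by
    rw [← Complex.ofReal_mul, Real.mul_self_sqrt (hQ.eigenvalues_nonneg r)]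
  simp only [Matrix.mul_diagonal, vecMulVec_apply, Pi.star_apply, star_apply, Function.comp,
    star_mul', Complex.star_def, Complex.conj_ofReal]
  simp only [RCLike.ofReal_eq_complex_ofReal, ← h]
  ring

lemma part1 {m n : ℕ} {W : Matrix (Fin m × Fin n) (Fin m × Fin n) ℂ} (hW : W.trace = 1)
    (hD : Decomposable W) (X Y : EuclideanSpace ℂ (Fin m × Fin n))
    (hX : ‖X‖ = 1) (hY : ‖Y‖ = 1) (hXY : inner ℂ X Y = 0) :
    -(Real.sqrt 2 / 2) ≤
      (star X.ofLp ⬝ᵥ W.mulVec X.ofLp).re + (star Y.ofLp ⬝ᵥ W.mulVec Y.ofLp).re := by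
  obtain ⟨P, Q, hP, hQ, rfl⟩ := hD
  obtain ⟨ψ, hψ⟩ := psd_factor hQ
  have hpt : ptrans Q = ∑ r, ptrans (vecMulVec (ψ r) (star (ψ r))) := by
    ext p q
    rw [Matrix.sum_apply]
    simp only [ptrans, hψ, Matrix.sum_apply]
  have htr : (P + ptrans Q).trace = P.trace + ∑ r, ∑ p, ((‖ψ r p‖ ^ 2 : ℝ) : ℂ) := by
    rw [Matrix.trace_add]
    congr 1
    rw [hpt, Matrix.trace_sum]
    refine Finset.sum_congr rfl fun r _ => Finset.sum_congr rfl fun p _ => ?_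
    simp only [diag_apply, ptrans, vecMulVec_apply, Pi.star_apply, Complex.star_def,
      Complex.mul_conj, Complex.normSq_eq_norm_sq]
  have hPt : 0 ≤ P.trace.re := (Complex.le_def.mp hP.trace_nonneg).1
  have htr' : P.trace.re + ∑ r, ∑ p, ‖ψ r p‖ ^ 2 = 1 := by
    have := congrArg Complex.re (htr.symm.trans hW)
    simpa [← Complex.ofReal_pow, ← Complex.ofReal_sum] using this
  have hPx : ∀ x : Fin m × Fin n → ℂ, 0 ≤ (star x ⬝ᵥ P.mulVec x).re := fun x =>
    (Complex.le_def.mp (hP.dotProduct_mulVec_nonneg x)).1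
  have hex : ∀ x : Fin m × Fin n → ℂ, (star x ⬝ᵥ (P + ptrans Q).mulVec x).re =
      (star x ⬝ᵥ P.mulVec x).re +
      ∑ r, (star x ⬝ᵥ (ptrans (vecMulVec (ψ r) (star (ψ r)))).mulVec x).re := by
    intro x
    rw [hpt, Matrix.add_mulVec, dotProduct_add, Complex.add_re, Matrix.sum_mulVec, dotProduct_sum,
      Complex.re_sum]
  rw [hex, hex]
  have hmain : ∑ r, -(Real.sqrt 2 / 2 * ∑ p, ‖ψ r p‖ ^ 2) ≤ _ :=
    Finset.sum_le_sum fun r (_ : r ∈ Finset.univ) => svd_form (ψ r) X Y hX hY hXY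
  rw [Finset.sum_neg_distrib, ← Finset.mul_sum, Finset.sum_add_distrib] at hmain
  have hs : 0 ≤ Real.sqrt 2 / 2 := by positivity
  have := hPx X.ofLp
  have := hPx Y.ofLp
  nlinarith

lemma eig_form {N : Type*} [Fintype N] [DecidableEq N] {W : Matrix N N ℂ} (hW : W.IsHermitian)
    (i : N) : (star (hW.eigenvectorBasis i).ofLp ⬝ᵥ W.mulVec (hW.eigenvectorBasis i).ofLp).re =
      hW.eigenvalues i := by
  have h := hW.eigenvalues_eq i
  rw [h]; rfl

lemma part1' {m n : ℕ} (h2 : 2 ≤ m * n) {W : Matrix (Fin m × Fin n) (Fin m × Fin n) ℂ}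
    (hH : W.IsHermitian) (hW : W.trace = 1) (hD : Decomposable W) :
    -(Real.sqrt 2 / 2) ≤ ((sortedEigs hH).drop (m * n - 2)).sum := by
  obtain ⟨p, q, hpq, hs, -⟩ := sort_drop hH.eigenvalues (by simpa using h2)
  simp only [Fintype.card_prod, Fintype.card_fin] at hs
  rw [sortedEigs, hs, ← eig_form, ← eig_form]
  have ho := hH.eigenvectorBasis.orthonormal
  exact part1 hW hD _ _ (ho.1 p) (ho.1 q) (ho.2 hpq)

/-- Ky Fan type upper bound for the two smallest eigenvalues -/
lemma kyfan {m n : ℕ} (h2 : 2 ≤ m * n) {W : Matrix (Fin m × Fin n) (Fin m × Fin n) ℂ}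
    (hH : W.IsHermitian) (X Y : EuclideanSpace ℂ (Fin m × Fin n)) (c : ℝ)
    (hX : ‖X‖ = 1) (hY : ‖Y‖ = 1) (hXY : inner ℂ X Y = 0)
    (hWX : W.mulVec X.ofLp = (c : ℂ) • X.ofLp) (hWY : W.mulVec Y.ofLp = (c : ℂ) • Y.ofLp) :
    ((sortedEigs hH).drop (m * n - 2)).sum ≤ 2 * c := by
  obtain ⟨p, q, hpq, hs, hmin⟩ := sort_drop hH.eigenvalues (by simpa using h2)
  simp only [Fintype.card_prod, Fintype.card_fin] at hs
  rw [sortedEigs, hs]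
  have ho := hH.eigenvectorBasis.orthonormal
  have key : ∀ (Z : EuclideanSpace ℂ (Fin m × Fin n)), W.mulVec Z.ofLp = (c : ℂ) • Z.ofLp → ∀ i,
      ‖inner ℂ (hH.eigenvectorBasis i) Z‖ ^ 2 * hH.eigenvalues i =
      ‖inner ℂ (hH.eigenvectorBasis i) Z‖ ^ 2 * c := by
    intro Z hZ i
    have e1 : (hH.eigenvalues i : ℂ) * inner ℂ (hH.eigenvectorBasis i) Z =
        c * inner ℂ (hH.eigenvectorBasis i) Z := by
      simp only [EuclideanSpace.inner_eq_star_dotProduct]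
      have h1 : (c : ℂ) * (Z.ofLp ⬝ᵥ star (hH.eigenvectorBasis i).ofLp) =
          W.mulVec Z.ofLp ⬝ᵥ star (hH.eigenvectorBasis i).ofLp := by
        rw [hZ, smul_dotProduct, smul_eq_mul]
      have h2 : star (hH.eigenvectorBasis i).ofLp ᵥ* W =
          star (W.mulVec (hH.eigenvectorBasis i).ofLp) := by
        rw [star_mulVec, hH.eq]
      rw [h1, dotProduct_comm (W.mulVec _), dotProduct_mulVec, h2,
        hH.mulVec_eigenvectorBasis, dotProduct_comm]
      simp [star_smul]
    by_cases h0 : inner ℂ (hH.eigenvectorBasis i) Z = 0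
    · rw [h0]; simp
    · have := mul_right_cancel₀ h0 e1
      rw [Complex.ofReal_inj.mp this]
  have hPX := hH.eigenvectorBasis.sum_sq_norm_inner_right X
  have hPY := hH.eigenvectorBasis.sum_sq_norm_inner_right Y
  rw [hX] at hPX
  rw [hY] at hPY
  have hsum : ∑ i, (‖inner ℂ (hH.eigenvectorBasis i) X‖ ^ 2 +
      ‖inner ℂ (hH.eigenvectorBasis i) Y‖ ^ 2) = 2 := by
    rw [Finset.sum_add_distrib, hPX, hPY]; norm_num
  have hb := kappa_bound Finset.univ (fun i => - hH.eigenvalues i)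
    (fun i => ‖inner ℂ (hH.eigenvectorBasis i) X‖ ^ 2 + ‖inner ℂ (hH.eigenvectorBasis i) Y‖ ^ 2)
    (-(hH.eigenvalues p + hH.eigenvalues q)) (fun i => by positivity)
    (fun i => bessel2 _ _ _ (ho.1 i) hX hY hXY) (Or.inl hsum) (Or.inr hsum)
    (fun i _ j _ hij => by have := hmin i j hij; linarith)
  have he : ∀ i, (‖inner ℂ (hH.eigenvectorBasis i) X‖ ^ 2 +
      ‖inner ℂ (hH.eigenvectorBasis i) Y‖ ^ 2) * (- hH.eigenvalues i) =
      (‖inner ℂ (hH.eigenvectorBasis i) X‖ ^ 2 +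
      ‖inner ℂ (hH.eigenvectorBasis i) Y‖ ^ 2) * (-c) := by
    intro i
    have := key X hWX i
    have := key Y hWY i
    linarith
  simp only [he] at hb
  rw [← Finset.sum_mul, hsum] at hb
  linarith

lemma bp_pure {m n : ℕ} (φ : Fin m × Fin n → ℂ) :
    BlockPositive (ptrans (vecMulVec φ (star φ))) := by
  constructor
  · ext p q
    simp [ptrans, vecMulVec_apply, mul_comm]
  · intro a b
    have h : star (prodVec a b) ⬝ᵥ (ptrans (vecMulVec φ (star φ))).mulVec (prodVec a b) =
        (∑ j, ∑ k, φ (j, k) * a j * star (b k)) * star (∑ j, ∑ k, φ (j, k) * a j * star (b k)) := by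
      simp only [dotProduct, mulVec, ptrans, vecMulVec_apply, Pi.star_apply, prodVec,
        Fintype.sum_prod_type, star_sum, star_mul', star_star, Finset.sum_mul, Finset.mul_sum]
      have hr : ∀ F : Fin m → Fin n → Fin m → Fin n → ℂ,
          ∑ i, ∑ k, ∑ j, ∑ l, F i k j l = ∑ i, ∑ l, ∑ j, ∑ k, F i k j l := by
        intro F
        refine Finset.sum_congr rfl fun i _ => ?_
        calc _ = ∑ j, ∑ k, ∑ l, F i k j l := Finset.sum_comm
          _ = ∑ j, ∑ l, ∑ k, F i k j l := Finset.sum_congr rfl fun k _ => Finset.sum_comm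
          _ = _ := Finset.sum_comm
      rw [hr]
      refine Finset.sum_congr rfl fun j _ => Finset.sum_congr rfl fun k _ =>
        Finset.sum_congr rfl fun i _ => Finset.sum_congr rfl fun l _ => by ring
    rw [h, Complex.star_def, Complex.mul_conj]
    exact ⟨by simpa using Complex.normSq_nonneg _, by simp⟩

lemma dec_pure {m n : ℕ} (φ : Fin m × Fin n → ℂ) :
    Decomposable (ptrans (vecMulVec φ (star φ))) :=
  ⟨0, vecMulVec φ (star φ), PosSemidef.zero, posSemidef_vecMulVec_self_star φ, by simp⟩

/-- The normalized antisymmetric vector. -/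
def asym {N : Type*} [Fintype N] [DecidableEq N] (a b : N) : EuclideanSpace ℂ N :=
  ((Real.sqrt 2 / 2 : ℝ) : ℂ) • (EuclideanSpace.single a 1 - EuclideanSpace.single b 1)

lemma asym_norm {N : Type*} [Fintype N] [DecidableEq N] (a b : N) (h : a ≠ b) :
    ‖asym a b‖ = 1 := by
  have hsC : ((Real.sqrt 2 : ℝ) : ℂ) * ((Real.sqrt 2 : ℝ) : ℂ) = 2 := by
    rw [← Complex.ofReal_mul, Real.mul_self_sqrt (by norm_num)]; simp
  have h1 : inner ℂ (asym a b) (asym a b) = 1 := by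
    simp only [asym, inner_smul_left, inner_smul_right, inner_sub_left, inner_sub_right,
      EuclideanSpace.inner_single_left, Complex.conj_ofReal]
    simp [h, h.symm]
    linear_combination (1/2) * hsC
  have h3 := inner_self_eq_norm_sq (𝕜 := ℂ) (asym a b)
  rw [h1] at h3
  have h2 : ‖asym a b‖ ^ 2 = 1 := by simpa using h3.symm
  nlinarith [norm_nonneg (asym a b)]

lemma asym_inner {N : Type*} [Fintype N] [DecidableEq N] (a b c d : N) (h1 : a ≠ c) (h2 : a ≠ d)
    (h3 : b ≠ c) (h4 : b ≠ d) : inner ℂ (asym a b) (asym c d) = 0 := by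
  simp only [asym, inner_smul_left, inner_smul_right, inner_sub_left, inner_sub_right,
      EuclideanSpace.inner_single_left, Complex.conj_ofReal]
  simp [h1, h2, h3, h4]

lemma asym_eig {m n : ℕ} (φ : Fin m × Fin n → ℂ) (i0 i1 : Fin m) (k0 k1 : Fin n) (a b : ℝ)
    (hi : i0 ≠ i1) (hk : k0 ≠ k1)
    (h0 : ∀ k, φ (i0, k) = if k = k0 then (a : ℂ) else 0)
    (h1 : ∀ k, φ (i1, k) = if k = k1 then (b : ℂ) else 0)
    (h2 : ∀ i, φ (i, k0) = if i = i0 then (a : ℂ) else 0)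
    (h3 : ∀ i, φ (i, k1) = if i = i1 then (b : ℂ) else 0) :
    (ptrans (vecMulVec φ (star φ))).mulVec (asym (i0, k1) (i1, k0)).ofLp =
      ((-(a * b) : ℝ) : ℂ) • (asym (i0, k1) (i1, k0)).ofLp := by
  simp only [asym, WithLp.ofLp_smul, WithLp.ofLp_sub, PiLp.ofLp_single, mulVec_smul,
    mulVec_sub, mulVec_single_one]
  ext ⟨i, k⟩
  simp only [Pi.smul_apply, Pi.sub_apply, Matrix.col_apply, ptrans, vecMulVec_apply, Pi.star_apply,
    h0, h1, h2, h3, Pi.single_apply, Prod.mk.injEq, smul_eq_mul]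
  by_cases c1 : k = k0
  · subst c1
    by_cases c3 : i = i0
    · subst c3; simp [hi, hk]
    · by_cases c4 : i = i1
      · subst c4; simp [hk, hi.symm]; ring
      · simp [hk, c3, c4]
  · by_cases c2 : k = k1
    · subst c2
      by_cases c3 : i = i0
      · subst c3; simp [hi, hk.symm]; ring
      · simp [hk.symm, c3]
    · simp [c1, c2]


lemma asym_not_psd {m n : ℕ} (M : Matrix (Fin m × Fin n) (Fin m × Fin n) ℂ) (c : ℝ) (hc : c < 0)
    (X : EuclideanSpace ℂ (Fin m × Fin n)) (hX : ‖X‖ = 1)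
    (h : M.mulVec X.ofLp = (c : ℂ) • X.ofLp) : ¬ M.PosSemidef := by
  intro hM
  have h1 := hM.dotProduct_mulVec_nonneg X.ofLp
  have h2 : star X.ofLp ⬝ᵥ X.ofLp = 1 := by
    rw [dotProduct_comm, ← EuclideanSpace.inner_eq_star_dotProduct, inner_self_eq_norm_sq_to_K, hX]
    simp
  rw [h, dotProduct_smul, h2, smul_eq_mul, mul_one] at h1
  have : 0 ≤ c := by exact_mod_cast h1
  linarith

theorem stmt_14 {m n : ℕ} (hm : 3 ≤ m) (hmn : m ≤ n)
    (φ : Fin m × Fin n → ℂ)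
    (hφ : φ = fun p =>
      if (p.1 : ℕ) = 0 ∧ (p.2 : ℕ) = 0 then ((Real.sqrt 2 / 2 : ℝ) : ℂ)
      else if (p.1 : ℕ) = 1 ∧ (p.2 : ℕ) = 1 then ((1 / 2 : ℝ) : ℂ)
      else if (p.1 : ℕ) = 2 ∧ (p.2 : ℕ) = 2 then ((1 / 2 : ℝ) : ℂ)
      else 0) :
    (∀ (W : Matrix (Fin m × Fin n) (Fin m × Fin n) ℂ)
      (hBP : BlockPositive W), ¬ W.PosSemidef → W.trace = 1 → Decomposable W →
      -(Real.sqrt 2 / 2) ≤ ((sortedEigs hBP.1).drop (m * n - 2)).sum) ∧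
    (∃ hBP : BlockPositive (ptrans (Matrix.vecMulVec φ (star φ))),
      ¬ (ptrans (Matrix.vecMulVec φ (star φ))).PosSemidef ∧
      (ptrans (Matrix.vecMulVec φ (star φ))).trace = 1 ∧
      Decomposable (ptrans (Matrix.vecMulVec φ (star φ))) ∧
      ((sortedEigs hBP.1).drop (m * n - 2)).sum = -(Real.sqrt 2 / 2)) := by
  have h2 : 2 ≤ m * n := by nlinarith
  refine ⟨fun W hBP _ htr hD => part1' h2 hBP.1 htr hD, bp_pure φ, ?_⟩
  let i0 : Fin m := ⟨0, by omega⟩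
  let i1 : Fin m := ⟨1, by omega⟩
  let i2 : Fin m := ⟨2, by omega⟩
  let k0 : Fin n := ⟨0, by omega⟩
  let k1 : Fin n := ⟨1, by omega⟩
  let k2 : Fin n := ⟨2, by omega⟩
  have r0 : ∀ k, φ (i0, k) = if k = k0 then ((Real.sqrt 2 / 2 : ℝ) : ℂ) else 0 := by
    intro k; rw [hφ]; simp [i0, k0, Fin.ext_iff]
  have r1 : ∀ k, φ (i1, k) = if k = k1 then ((1 / 2 : ℝ) : ℂ) else 0 := by
    intro k; rw [hφ]; simp [i1, k1, Fin.ext_iff]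
  have r2 : ∀ k, φ (i2, k) = if k = k2 then ((1 / 2 : ℝ) : ℂ) else 0 := by
    intro k; rw [hφ]; simp [i2, k2, Fin.ext_iff]
  have c0 : ∀ i, φ (i, k0) = if i = i0 then ((Real.sqrt 2 / 2 : ℝ) : ℂ) else 0 := by
    intro k; rw [hφ]; simp [i0, k0, Fin.ext_iff]
  have c1 : ∀ i, φ (i, k1) = if i = i1 then ((1 / 2 : ℝ) : ℂ) else 0 := by
    intro k; rw [hφ]; simp [i1, k1, Fin.ext_iff]
  have c2 : ∀ i, φ (i, k2) = if i = i2 then ((1 / 2 : ℝ) : ℂ) else 0 := by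
    intro k; rw [hφ]; simp [i2, k2, Fin.ext_iff]
  have hz : ∀ p : Fin m × Fin n, p ∉ ({(i0, k0), (i1, k1), (i2, k2)} : Finset _) → φ p = 0 := by
    rintro ⟨i, k⟩ hp
    simp only [Finset.mem_insert, Finset.mem_singleton, Prod.mk.injEq, i0, i1, i2, k0, k1, k2,
      Fin.ext_iff, not_or] at hp
    rw [hφ]
    simp only
    rw [if_neg hp.1, if_neg hp.2.1, if_neg hp.2.2]
  have htr : (ptrans (Matrix.vecMulVec φ (star φ))).trace = 1 := by
    have e1 : (ptrans (Matrix.vecMulVec φ (star φ))).trace = ∑ p, φ p * star (φ p) := rfl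
    rw [e1, ← Finset.sum_subset (Finset.subset_univ ({(i0, k0), (i1, k1), (i2, k2)} : Finset _))
      (fun p _ hp => by rw [hz p hp]; simp)]
    rw [Finset.sum_insert (by simp [i0, i1, i2]), Finset.sum_insert (by simp [i1, i2]),
      Finset.sum_singleton, r0, r1, r2, if_pos rfl, if_pos rfl, if_pos rfl]
    simp only [Complex.star_def, Complex.conj_ofReal, ← Complex.ofReal_mul, ← Complex.ofReal_add]
    have : Real.sqrt 2 / 2 * (Real.sqrt 2 / 2) + (1 / 2 * (1 / 2) + 1 / 2 * (1 / 2)) = 1 := by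
      nlinarith [Real.sq_sqrt (show (0:ℝ) ≤ 2 by norm_num)]
    rw [this]; simp
  have e1 := asym_eig φ i0 i1 k0 k1 _ _ (by simp [i0, i1]) (by simp [k0, k1]) r0 r1 c0 c1
  have e2 := asym_eig φ i0 i2 k0 k2 _ _ (by simp [i0, i2]) (by simp [k0, k2]) r0 r2 c0 c2
  have n1 : ‖asym (i0, k1) (i1, k0)‖ = 1 := asym_norm _ _ (by simp [i0, i1])
  have n2 : ‖asym (i0, k2) (i2, k0)‖ = 1 := asym_norm _ _ (by simp [i0, i2])
  have hin : inner ℂ (asym (i0, k1) (i1, k0)) (asym (i0, k2) (i2, k0)) = 0 :=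
    asym_inner _ _ _ _ (by simp [k1, k2]) (by simp [i0, i2]) (by simp [i0, i1]) (by simp [i1, i2])
  have hs : 0 < Real.sqrt 2 := by positivity
  refine ⟨asym_not_psd _ _ (by linarith) _ n1 e1, htr, dec_pure φ, le_antisymm ?_ ?_⟩
  · refine (kyfan h2 (bp_pure φ).1 _ _ _ n1 n2 hin e1 e2).trans (le_of_eq (by ring))
  · exact part1' h2 (bp_pure φ).1 htr (dec_pure φ)

end
end

section
/- Let 3 ≤ m ≤ n and let W be a normalized m×n decomposable entanglement witness with eigenvalues λ_1 ≥ λ_2 ≥ … ≥ λ_{mn} listed in non-increasing order with multiplicity. Then the sum of the three smallest eigenvalues satisfies λ_{mn} + λ_{mn−1} + λ_{mn−2} ≥ −1. Moreover, equality is attained: for φ = (1/√3)(e₁⊗f₁ + e₂⊗f₂ + e₃⊗f₃) (e_i, f_i standard basis vectors of ℂ^m and ℂ^n), the matrix W = (φ φᴴ)^Γ is a normalized m×n decomposable entanglement witness whose three smallest eigenvalues sum to −1. -/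
open Matrix ComplexOrder

noncomputable section

lemma aux_comb {ι : Type*} [Fintype ι] [DecidableEq ι] (p : ι → ι → ℝ) (s : ι → ℝ)
    (p0 : ∀ i j, 0 ≤ p i j) (p1 : ∀ i j, p i j ≤ 1) (psymm : ∀ i j, p i j = p j i)
    (pdiag : ∀ i, p i i = 0) (psum : ∑ i, ∑ j, p i j ≤ 6) :
    ∑ i, ∑ j, p i j * (s i * s j) ≤ 2 * ∑ i, s i ^ 2 := by
  set d : ι → ℝ := fun i => ∑ j, p i j with hd
  have d0 : ∀ i, 0 ≤ d i := fun i => Finset.sum_nonneg fun j _ => p0 i j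
  have hpd : ∀ i j, p i j ≤ d i := fun i j =>
    Finset.single_le_sum (f := fun j => p i j) (fun j _ => p0 i j) (Finset.mem_univ j)
  -- degree bound
  have hdd : ∀ i j, i ≠ j → d i + d j ≤ 4 := by
    intro i j hij
    have h1 : ∑ k, d k = d i + (d j + ∑ k ∈ (Finset.univ.erase i).erase j, d k) := by
      rw [Finset.add_sum_erase _ _ (by simp [Ne.symm hij]), Finset.add_sum_erase _ _ (by simp)]
    have h2 : ∑ k ∈ (Finset.univ.erase i).erase j, (p k i + p k j)
        ≤ ∑ k ∈ (Finset.univ.erase i).erase j, d k := by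
      refine Finset.sum_le_sum fun k _ => ?_
      have : ∑ l ∈ ({i, j} : Finset ι), p k l ≤ d k :=
        Finset.sum_le_sum_of_subset_of_nonneg (Finset.subset_univ _) (fun l _ _ => p0 k l)
      rwa [Finset.sum_pair hij] at this
    have h3 : d i = p i i + (p i j + ∑ k ∈ (Finset.univ.erase i).erase j, p i k) := by
      rw [Finset.add_sum_erase _ _ (by simp [Ne.symm hij]), Finset.add_sum_erase _ _ (by simp)]
    have h4 : d j = p j i + (p j j + ∑ k ∈ (Finset.univ.erase i).erase j, p j k) := by
      rw [Finset.add_sum_erase _ (fun k => p j k) (by simp [Ne.symm hij]), Finset.add_sum_erase _ (fun k => p j k) (by simp)]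
    rw [Finset.sum_add_distrib] at h2
    simp_rw [fun k => psymm k i, fun k => psymm k j] at h2
    have h5 : ∑ k, d k ≤ 6 := psum
    have := p1 i j
    have := psymm i j
    have := pdiag i
    have := pdiag j
    linarith
  have key : ∀ i j, p i j * (s i * s j) ≤ p i j * (s i ^ 2 / d i) + p j i * (s j ^ 2 / d j) := by
    intro i j
    rcases eq_or_lt_of_le (p0 i j) with h | h
    · rw [← psymm i j, ← h]; simp
    · have hij : i ≠ j := by rintro rfl; rw [pdiag] at h; exact lt_irrefl _ h
      have hi : 0 < d i := lt_of_lt_of_le h (hpd i j)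
      have hj : 0 < d j := lt_of_lt_of_le h (by rw [psymm]; exact hpd j i)
      rw [← psymm i j, ← mul_add]
      refine mul_le_mul_of_nonneg_left ?_ h.le
      have h4 : d i * d j ≤ 4 := by nlinarith [hdd i j hij, sq_nonneg (d i - d j)]
      rw [div_add_div _ _ hi.ne' hj.ne', le_div_iff₀ (by positivity)]
      by_cases hs : s i * s j ≤ 0
      · have : 0 ≤ s i ^ 2 * d j + d i * s j ^ 2 := by positivity
        nlinarith [mul_pos hi hj]
      · push Not at hs
        set D := d i * d j
        have hD : 0 < D := by positivity
        set X := s i ^ 2 * d j + d i * s j ^ 2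
        have hX : 0 ≤ X := by positivity
        refine abs_le_of_sq_le_sq' ?_ hX |>.2
        have e1 : 4 * D * (s i * s j) ^ 2 ≤ X ^ 2 := by
          have : X ^ 2 - 4 * D * (s i * s j) ^ 2 = (s i ^ 2 * d j - d i * s j ^ 2) ^ 2 := by
            simp only [X, D]; ring
          nlinarith [sq_nonneg (s i ^ 2 * d j - d i * s j ^ 2)]
        have e2 : D * (D * (s i * s j) ^ 2) ≤ 4 * (D * (s i * s j) ^ 2) :=
          mul_le_mul_of_nonneg_right h4 (by positivity)
        nlinarith
  have hrow : ∀ i, ∑ j, p i j * (s i ^ 2 / d i) ≤ s i ^ 2 := by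
    intro i
    rw [← Finset.sum_mul]
    change d i * _ ≤ _
    rcases eq_or_lt_of_le (d0 i) with h | h
    · rw [← h]; simp; positivity
    · rw [mul_div_cancel₀ _ h.ne']
  calc ∑ i, ∑ j, p i j * (s i * s j)
      ≤ ∑ i, ∑ j, (p i j * (s i ^ 2 / d i) + p j i * (s j ^ 2 / d j)) :=
        Finset.sum_le_sum fun i _ => Finset.sum_le_sum fun j _ => key i j
    _ = ∑ i, ∑ j, p i j * (s i ^ 2 / d i) + ∑ i, ∑ j, p j i * (s j ^ 2 / d j) := by
        simp_rw [Finset.sum_add_distrib]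
    _ = 2 * ∑ i, ∑ j, p i j * (s i ^ 2 / d i) := by
        rw [Finset.sum_comm (f := fun i j => p j i * (s j ^ 2 / d j))]; ring
    _ ≤ 2 * ∑ i, s i ^ 2 := by
        have := Finset.sum_le_sum fun i (_ : i ∈ Finset.univ) => hrow i
        linarith

lemma aux_bessel {E ι : Type*} [NormedAddCommGroup E] [InnerProductSpace ℂ E] [Fintype ι]
    (g : ι → E) (h1 : ∀ i, ‖g i‖ ≤ 1)
    (h0 : ∀ i j, i ≠ j → inner ℂ (g i) (g j) = 0) (x : E) :
    ∑ i, ‖inner ℂ (g i) x‖ ^ 2 ≤ ‖x‖ ^ 2 := by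
  classical
  set y := ∑ i, (inner ℂ (g i) x) • g i with hy
  have hxy : RCLike.re (inner ℂ x y) = ∑ i, ‖inner ℂ (g i) x‖ ^ 2 := by
    rw [hy, inner_sum, map_sum]
    refine Finset.sum_congr rfl fun i _ => ?_
    rw [inner_smul_right, ← inner_conj_symm x (g i), RCLike.mul_conj]
    norm_cast
  have hyy : RCLike.re (inner ℂ y y) ≤ ∑ i, ‖inner ℂ (g i) x‖ ^ 2 := by
    conv_lhs => rw [hy]
    rw [sum_inner, map_sum]
    refine Finset.sum_le_sum fun i _ => ?_
    rw [inner_sum, Finset.sum_eq_single i]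
    · rw [inner_smul_right, inner_smul_left, inner_self_eq_norm_sq_to_K, ← mul_assoc, RCLike.mul_conj]
      have : ‖g i‖ ^ 2 ≤ 1 := by nlinarith [h1 i, norm_nonneg (g i)]
      have h2 : ‖inner ℂ (g i) x‖ ^ 2 * ‖g i‖ ^ 2 ≤ ‖inner ℂ (g i) x‖ ^ 2 := by
        nlinarith [sq_nonneg ‖inner ℂ (g i) x‖]
      refine le_trans (le_of_eq ?_) h2
      norm_cast
    · intro j _ hj
      rw [inner_smul_right, inner_smul_left, h0 i j (Ne.symm hj)]; simp
    · simp
  have := @norm_sub_sq ℂ E _ _ _ x y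
  have h3 : ‖y‖ ^ 2 = RCLike.re (inner ℂ y y) := norm_sq_eq_re_inner y
  nlinarith [sq_nonneg ‖x - y‖]

lemma aux_abstract {E ι : Type*} [NormedAddCommGroup E] [InnerProductSpace ℂ E] [Fintype ι]
    [DecidableEq ι] (g : ι × ι → E) (h1 : ∀ i, ‖g i‖ ≤ 1)
    (h0 : ∀ i j, i ≠ j → inner ℂ (g i) (g j) = 0) (s : ι → ℝ) (s0 : ∀ i, 0 ≤ s i)
    (v : Fin 3 → E) (hv : Orthonormal ℂ v) :
    - ∑ i, s i ^ 2 ≤ ∑ r, ∑ a, ∑ c, s a * s c *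
      (inner ℂ (v r) (g (c, a)) * (starRingEnd ℂ) (inner ℂ (v r) (g (a, c)))).re := by
  set p : ι → ι → ℝ := fun a c =>
    ∑ r, ‖inner ℂ (v r) (g (c, a)) - inner ℂ (v r) (g (a, c))‖ ^ 2 / 2 with hp
  have hcomb : ∑ a, ∑ c, p a c * (s a * s c) ≤ 2 * ∑ i, s i ^ 2 := by
    apply aux_comb
    · intro i j; positivity
    · intro i j
      have e : ∀ r, ‖inner ℂ (v r) (g (j, i)) - inner ℂ (v r) (g (i, j))‖ ^ 2 / 2
          = ‖inner ℂ (v r) (g (j, i) - g (i, j))‖ ^ 2 / 2 := by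
        intro r; rw [inner_sub_right]
      simp only [p, e]
      rw [← Finset.sum_div]
      have b := hv.sum_inner_products_le (s := Finset.univ) (g (j, i) - g (i, j))
      have h2 : ‖g (j, i) - g (i, j)‖ ^ 2 ≤ 2 := by
        by_cases hij : i = j
        · subst hij; simp
        · rw [@norm_sub_sq ℂ, h0 _ _ (by simp; tauto)]
          have := h1 (i, j); have := h1 (j, i)
          simp only [map_zero]
          nlinarith [norm_nonneg (g (i, j)), norm_nonneg (g (j, i))]
      linarith
    · intro i j
      simp only [p]
      refine Finset.sum_congr rfl fun r _ => ?_
      rw [norm_sub_rev]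
    · intro i; simp [p]
    · have hr : ∀ r, ∑ a, ∑ c, ‖inner ℂ (v r) (g (c, a)) - inner ℂ (v r) (g (a, c))‖ ^ 2 / 2 ≤ 2 := by
        intro r
        have b := aux_bessel g h1 h0 (v r)
        rw [hv.1 r, Fintype.sum_prod_type] at b
        simp_rw [norm_inner_symm _ (v r)] at b
        have : ∀ a c, ‖inner ℂ (v r) (g (c, a)) - inner ℂ (v r) (g (a, c))‖ ^ 2 / 2 ≤
            ‖inner ℂ (v r) (g (c, a))‖ ^ 2 + ‖inner ℂ (v r) (g (a, c))‖ ^ 2 := by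
          intro a c
          have := norm_sub_le (inner ℂ (v r) (g (c, a))) (inner ℂ (v r) (g (a, c)))
          nlinarith [norm_nonneg (inner ℂ (v r) (g (c, a)) - inner ℂ (v r) (g (a, c))),
            sq_nonneg (‖inner ℂ (v r) (g (c, a))‖ - ‖inner ℂ (v r) (g (a, c))‖)]
        have h2 := Finset.sum_le_sum fun a (_ : a ∈ Finset.univ) =>
          Finset.sum_le_sum fun c (_ : c ∈ Finset.univ) => this a c
        simp_rw [Finset.sum_add_distrib] at h2
        rw [Finset.sum_comm (f := fun a c => ‖inner ℂ (v r) (g (c, a))‖ ^ 2)] at h2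
        linarith
      have : ∑ a, ∑ c, p a c = ∑ r, ∑ a, ∑ c,
          ‖inner ℂ (v r) (g (c, a)) - inner ℂ (v r) (g (a, c))‖ ^ 2 / 2 := by
        simp only [p]
        rw [Finset.sum_comm]
        conv_rhs => rw [Finset.sum_comm]
        rw [Finset.sum_comm]
        refine Finset.sum_congr rfl fun a _ => ?_
        rw [Finset.sum_comm]
      rw [this]
      have := Finset.sum_le_sum fun r (_ : r ∈ Finset.univ) => hr r
      simp at this
      linarith
  have hpt : ∀ x y : ℂ, -(‖x - y‖ ^ 2 / 2) / 2 ≤ (x * (starRingEnd ℂ) y).re := by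
    intro x y
    rw [Complex.sq_norm, Complex.normSq_apply]
    simp
    nlinarith [sq_nonneg (x.re + y.re), sq_nonneg (x.im + y.im)]
  have e : ∑ a, ∑ c, p a c * (s a * s c) = ∑ r, ∑ a, ∑ c, s a * s c *
      (‖inner ℂ (v r) (g (c, a)) - inner ℂ (v r) (g (a, c))‖ ^ 2 / 2) := by
    rw [Finset.sum_comm (s := (Finset.univ : Finset (Fin 3)))]
    refine Finset.sum_congr rfl fun a _ => ?_
    rw [Finset.sum_comm (s := (Finset.univ : Finset (Fin 3)))]
    refine Finset.sum_congr rfl fun c _ => ?_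
    simp only [p]
    rw [mul_comm, Finset.mul_sum]
  have : ∑ r, ∑ a, ∑ c, s a * s c *
      (-(‖inner ℂ (v r) (g (c, a)) - inner ℂ (v r) (g (a, c))‖ ^ 2 / 2) / 2) ≤
      ∑ r, ∑ a, ∑ c, s a * s c *
      (inner ℂ (v r) (g (c, a)) * (starRingEnd ℂ) (inner ℂ (v r) (g (a, c)))).re :=
    Finset.sum_le_sum fun r _ => Finset.sum_le_sum fun a _ => Finset.sum_le_sum fun c _ =>
      mul_le_mul_of_nonneg_left (hpt _ _) (mul_nonneg (s0 a) (s0 c))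
  refine le_trans ?_ this
  have e3 : ∑ r, ∑ a, ∑ c, s a * s c *
      (-(‖inner ℂ (v r) (g (c, a)) - inner ℂ (v r) (g (a, c))‖ ^ 2 / 2) / 2) =
      (- 1 / 2) * ∑ a, ∑ c, p a c * (s a * s c) := by
    rw [e]
    simp_rw [Finset.mul_sum]
    refine Finset.sum_congr rfl fun r _ => Finset.sum_congr rfl fun a _ =>
      Finset.sum_congr rfl fun c _ => ?_
    ring
  rw [e3]
  linarith

lemma aux_rank1 {m n : ℕ} (ψ : Fin m × Fin n → ℂ)
    (v : Fin 3 → EuclideanSpace ℂ (Fin m × Fin n)) (hv : Orthonormal ℂ v) :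
    - ∑ p, ‖ψ p‖ ^ 2 ≤ ∑ r, (star (v r).ofLp ⬝ᵥ
      (ptrans (Matrix.vecMulVec ψ (star ψ))).mulVec (v r).ofLp).re := by
  set A : Matrix (Fin m) (Fin n) ℂ := Matrix.of fun i k => ψ (i, k) with hA
  have hH : (A * Aᴴ).IsHermitian := Matrix.isHermitian_mul_conjTranspose_self A
  set U : Matrix (Fin m) (Fin m) ℂ := (hH.eigenvectorUnitary : Matrix (Fin m) (Fin m) ℂ) with hU
  have hUU : Uᴴ * U = 1 := Unitary.coe_star_mul_self hH.eigenvectorUnitary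
  have hUU' : U * Uᴴ = 1 := Unitary.coe_mul_star_self hH.eigenvectorUnitary
  set B : Matrix (Fin m) (Fin n) ℂ := Uᴴ * A with hB
  have hAB : A = U * B := by rw [hB, ← Matrix.mul_assoc, hUU', Matrix.one_mul]
  have hBB : B * Bᴴ = Matrix.diagonal (fun i => ((hH.eigenvalues i : ℝ) : ℂ)) := by
    have := hH.conjStarAlgAut_star_eigenvectorUnitary
    rw [Unitary.conjStarAlgAut_apply] at this
    rw [hB, Matrix.conjTranspose_mul, Matrix.conjTranspose_conjTranspose]
    simp only [Matrix.mul_assoc] at this ⊢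
    simpa [Matrix.star_eq_conjTranspose, ← hU, Function.comp_def] using this
  set ev := hH.eigenvalues with hev
  have hBrow : ∀ a c, ∑ k, B a k * star (B c k) = if a = c then ((ev a : ℝ) : ℂ) else 0 := by
    intro a c
    have := congrFun (congrFun hBB a) c
    rw [Matrix.mul_apply, Matrix.diagonal_apply] at this
    simpa using this
  have hBn : ∀ a, ∑ k, ‖B a k‖ ^ 2 = ev a := by
    intro a
    have := hBrow a a
    rw [if_pos rfl] at this
    have h2 : ((∑ k, ‖B a k‖ ^ 2 : ℝ) : ℂ) = ((ev a : ℝ) : ℂ) := by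
      rw [← this]; push_cast
      exact Finset.sum_congr rfl fun k _ => (Complex.mul_conj' _).symm
    exact_mod_cast h2
  have ev0 : ∀ a, 0 ≤ ev a := fun a => by rw [← hBn a]; positivity
  set s : Fin m → ℝ := fun a => Real.sqrt (ev a) with hs
  have ss : ∀ a, s a * s a = ev a := fun a => Real.mul_self_sqrt (ev0 a)
  have hBs : ∀ a k, ((s a : ℝ) : ℂ) * (B a k / (s a : ℂ)) = B a k := by
    intro a k
    by_cases h : s a = 0
    · have : ev a = 0 := by rw [← ss, h]; simp
      have h3 := hBn a
      rw [this, Finset.sum_eq_zero_iff_of_nonneg (fun _ _ => by positivity)] at h3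
      have := h3 k (Finset.mem_univ _)
      simp at this
      simp [this]
    · have : (s a : ℂ) ≠ 0 := by exact_mod_cast h
      field_simp
  have hsum : ∑ a, s a ^ 2 = ∑ p, ‖ψ p‖ ^ 2 := by
    have h1 := hH.trace_eq_sum_eigenvalues
    have h2 : (A * Aᴴ).trace = ((∑ p, ‖ψ p‖ ^ 2 : ℝ) : ℂ) := by
      rw [Fintype.sum_prod_type]
      simp only [Matrix.trace, Matrix.diag, Matrix.mul_apply, Matrix.conjTranspose_apply]
      push_cast
      refine Finset.sum_congr rfl fun i _ => Finset.sum_congr rfl fun k _ => ?_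
      simp only [hA, Matrix.of_apply]
      exact (Complex.mul_conj' _)
    rw [h2] at h1
    have h3 : (∑ p, ‖ψ p‖ ^ 2 : ℝ) = ∑ a, ev a := by
      apply Complex.ofReal_injective
      rw [h1]; push_cast; rfl
    rw [h3]
    exact Finset.sum_congr rfl fun a _ => by rw [sq, ss]
  set g : Fin m × Fin m → EuclideanSpace ℂ (Fin m × Fin n) := fun q =>
    WithLp.toLp 2 (fun p => star (U p.1 q.1) * (B q.2 p.2 / (s q.2 : ℂ))) with hg
  have hgin : ∀ q q', inner ℂ (g q) (g q') =
      (if q.1 = q'.1 then 1 else 0) * (if q.2 = q'.2 then ((ev q.2 / (s q.2 * s q.2) : ℝ) : ℂ) else 0) := by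
    intro q q'
    have e1 : ∑ i, U i q.1 * star (U i q'.1) = if q.1 = q'.1 then 1 else 0 := by
      have := congrFun (congrFun hUU q'.1) q.1
      rw [Matrix.mul_apply, Matrix.one_apply] at this
      simp only [Matrix.conjTranspose_apply] at this
      simp_rw [mul_comm (U _ q.1), this, eq_comm]
    have e2 : ∑ k, star (B q.2 k / (s q.2 : ℂ)) * (B q'.2 k / (s q'.2 : ℂ)) =
        (if q.2 = q'.2 then ((ev q.2 / (s q.2 * s q.2) : ℝ) : ℂ) else 0) := by
      have : ∀ k, star (B q.2 k / (s q.2 : ℂ)) * (B q'.2 k / (s q'.2 : ℂ)) =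
          (B q'.2 k * star (B q.2 k)) / ((s q.2 : ℂ) * (s q'.2 : ℂ)) := by
        intro k
        rw [star_div₀]
        have : star (s q.2 : ℂ) = (s q.2 : ℂ) := Complex.conj_ofReal _
        rw [this, div_mul_div_comm, mul_comm (star _)]
      simp_rw [this]
      rw [← Finset.sum_div, hBrow]
      by_cases h : q.2 = q'.2
      · rw [if_pos h.symm, if_pos h, ← h]; push_cast; rfl
      · rw [if_neg (Ne.symm h), if_neg h, zero_div]
    rw [← e1, ← e2, Finset.sum_mul_sum, EuclideanSpace.inner_eq_star_dotProduct, dotProduct,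
      Fintype.sum_prod_type]
    refine Finset.sum_congr rfl fun i _ => Finset.sum_congr rfl fun k _ => ?_
    simp only [hg, Pi.star_apply, star_mul', star_star]
    ring
  have key := aux_abstract g ?_ ?_ s (fun a => Real.sqrt_nonneg _) v hv
  · rw [hsum] at key
    refine key.trans (le_of_eq ?_)
    refine Finset.sum_congr rfl fun r _ => ?_
    have e1 : ∀ a c, (s a : ℂ) * inner ℂ (v r) (g (c, a)) =
        ∑ i, ∑ k, star (v r (i, k)) * (star (U i c) * B a k) := by
      intro a c
      rw [EuclideanSpace.inner_eq_star_dotProduct, dotProduct, Fintype.sum_prod_type, Finset.mul_sum]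
      refine Finset.sum_congr rfl fun i _ => ?_
      rw [Finset.mul_sum]
      refine Finset.sum_congr rfl fun k _ => ?_
      have h := hBs a k
      simp only [hg, Pi.star_apply]
      calc _ = star ((v r) (i, k)) * (star (U i c) * ((s a : ℂ) * (B a k / (s a : ℂ)))) := by ring
        _ = _ := by rw [h]
    set V : Matrix (Fin m) (Fin n) ℂ := Matrix.of fun i k => v r (i, k) with hV
    set X : Matrix (Fin m) (Fin m) ℂ := B * Vᴴ * Uᴴᵀ with hX
    have hXe : ∀ a c, (s a : ℂ) * inner ℂ (v r) (g (c, a)) = X a c := by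
      intro a c
      rw [e1, hX, Matrix.mul_apply]
      refine Finset.sum_congr rfl fun i _ => ?_
      rw [Matrix.mul_apply, Finset.sum_mul]
      refine Finset.sum_congr rfl fun k _ => ?_
      simp only [Matrix.conjTranspose_apply, Matrix.transpose_apply, hV, Matrix.of_apply]
      ring
    have e2 : ∑ a, ∑ c, s a * s c *
        (inner ℂ (v r) (g (c, a)) * (starRingEnd ℂ) (inner ℂ (v r) (g (a, c)))).re
        = ((X * Xᴴᵀ).trace).re := by
      simp only [Matrix.trace, Matrix.diag, Matrix.mul_apply, Complex.re_sum]
      refine Finset.sum_congr rfl fun a _ => Finset.sum_congr rfl fun c _ => ?_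
      rw [Matrix.transpose_apply, Matrix.conjTranspose_apply, ← hXe, ← hXe]
      rw [← Complex.re_ofReal_mul]
      congr 1
      rw [star_mul']
      have : star (s c : ℂ) = (s c : ℂ) := Complex.conj_ofReal _
      rw [this, starRingEnd_apply]
      push_cast
      ring
    have e3 : (X * Xᴴᵀ).trace = (A * Vᴴ * (Aᴴᵀ * Vᵀ)).trace := by
      have hA2 : Aᴴᵀ = Uᴴᵀ * Bᴴᵀ := by
        rw [hAB, Matrix.conjTranspose_mul, Matrix.transpose_mul]
      have hX2 : Xᴴᵀ = Bᴴᵀ * Vᵀ * U := by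
        rw [hX]
        simp only [Matrix.conjTranspose_mul, Matrix.transpose_mul, Matrix.conjTranspose_conjTranspose]
        have : (Uᴴᵀᴴ)ᵀ = U := by ext; simp
        rw [this, Matrix.mul_assoc]
      rw [hA2, hX2, hX]
      conv_rhs => rw [hAB]
      rw [show B * Vᴴ * Uᴴᵀ * (Bᴴᵀ * Vᵀ * U) = (B * Vᴴ * Uᴴᵀ * (Bᴴᵀ * Vᵀ)) * U by
        simp only [Matrix.mul_assoc], Matrix.trace_mul_comm]
      simp only [Matrix.mul_assoc]
    rw [e2, e3]
    congr 1
    simp only [Matrix.trace, Matrix.diag, Matrix.mul_apply, dotProduct, Matrix.mulVec,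
      Fintype.sum_prod_type, Finset.mul_sum, Finset.sum_mul, Matrix.conjTranspose_apply,
      Matrix.transpose_apply, ptrans, Matrix.vecMulVec_apply, Pi.star_apply, hV, hA, Matrix.of_apply]
    -- left: sum over j i l k, right: sum over i k j l
    rw [Finset.sum_comm]
    refine Finset.sum_congr rfl fun i _ => ?_
    conv_rhs => rw [Finset.sum_comm]
    refine Finset.sum_congr rfl fun j _ => ?_
    rw [Finset.sum_comm]
    refine Finset.sum_congr rfl fun k _ => Finset.sum_congr rfl fun l _ => ?_
    ring
  · intro q
    have h : ‖g q‖ ^ 2 ≤ 1 := by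
      rw [@norm_sq_eq_re_inner ℂ, hgin]
      simp only [if_true, one_mul]
      rw [ss]
      rw [show ∀ x : ℝ, RCLike.re ((x : ℝ) : ℂ) = x from fun x => Complex.ofReal_re x]
      exact div_self_le_one _
    exact (sq_le_one_iff₀ (norm_nonneg _)).1 h
  · intro q q' hqq
    rw [hgin]
    by_cases h : q.1 = q'.1
    · have : q.2 ≠ q'.2 := fun h' => hqq (Prod.ext h h')
      simp [this]
    · simp [h]


open scoped MatrixOrder in
lemma aux_psd {N : Type*} [Fintype N] [DecidableEq N] {Q : Matrix N N ℂ} (hQ : Q.PosSemidef) :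
    ∃ B : Matrix N N ℂ, Q = Bᴴ * B :=
  CStarAlgebra.nonneg_iff_eq_star_mul_self.mp hQ.nonneg

lemma aux_ptransQ {m n : ℕ} {Q : Matrix (Fin m × Fin n) (Fin m × Fin n) ℂ} (hQ : Q.PosSemidef)
    (v : Fin 3 → EuclideanSpace ℂ (Fin m × Fin n)) (hv : Orthonormal ℂ v) :
    - Q.trace.re ≤ ∑ r, (star (v r).ofLp ⬝ᵥ (ptrans Q).mulVec (v r).ofLp).re := by
  obtain ⟨B, rfl⟩ := aux_psd hQ
  have e : ptrans (Bᴴ * B) = ∑ k, ptrans (Matrix.vecMulVec (star (B k)) (star (star (B k)))) := by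
    ext p q
    simp [ptrans, Matrix.sum_apply, Matrix.mul_apply, Matrix.vecMulVec_apply]
  have et : (Bᴴ * B).trace.re = ∑ k, ∑ p, ‖star (B k) p‖ ^ 2 := by
    simp only [Matrix.trace, Matrix.diag, Matrix.mul_apply, Complex.re_sum]
    rw [Finset.sum_comm]
    refine Finset.sum_congr rfl fun k _ => Finset.sum_congr rfl fun p _ => ?_
    rw [Matrix.conjTranspose_apply, Pi.star_apply, norm_star, ← starRingEnd_apply,
      Complex.conj_mul']
    norm_cast
  rw [e, et]
  simp_rw [Matrix.sum_mulVec, dotProduct_sum, Complex.re_sum]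
  rw [← Finset.sum_neg_distrib]
  conv_rhs => rw [Finset.sum_comm]
  exact Finset.sum_le_sum fun k _ => aux_rank1 (star (B k)) v hv

lemma aux_decomp {m n : ℕ} {W : Matrix (Fin m × Fin n) (Fin m × Fin n) ℂ} (hW : Decomposable W)
    (ht : W.trace = 1) (v : Fin 3 → EuclideanSpace ℂ (Fin m × Fin n)) (hv : Orthonormal ℂ v) :
    -1 ≤ ∑ r, (star (v r).ofLp ⬝ᵥ W.mulVec (v r).ofLp).re := by
  obtain ⟨P, Q, hP, hQ, rfl⟩ := hW
  have h1 := aux_ptransQ hQ v hv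
  have h2 : 0 ≤ P.trace.re := (Complex.le_def.1 hP.trace_nonneg).1
  have h3 : P.trace.re + Q.trace.re = 1 := by
    have : (P + ptrans Q).trace = P.trace + Q.trace := by rw [Matrix.trace_add]; rfl
    rw [this] at ht
    rw [← Complex.add_re, ht]; simp
  have h4 : 0 ≤ ∑ r, (star (v r).ofLp ⬝ᵥ P.mulVec (v r).ofLp).re :=
    Finset.sum_nonneg fun r _ => (Complex.le_def.1 (hP.dotProduct_mulVec_nonneg _)).1
  simp_rw [Matrix.add_mulVec, dotProduct_add, Complex.add_re, Finset.sum_add_distrib]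
  linarith

lemma aux_le_map {α β : Type*} (f : α → β) (s : Multiset α) (u : Multiset β)
    (h : u ≤ s.map f) : ∃ t ≤ s, t.map f = u := by
  induction s using Multiset.induction generalizing u with
  | empty => exact ⟨0, le_rfl, by simpa using (Multiset.le_zero.1 (by simpa using h)).symm⟩
  | cons a s ih =>
    classical
    rw [Multiset.map_cons] at h
    by_cases hu : f a ∈ u
    · obtain ⟨u', rfl⟩ := Multiset.exists_cons_of_mem hu
      obtain ⟨t, ht, rfl⟩ := ih u' ((Multiset.cons_le_cons_iff _).1 h)
      exact ⟨a ::ₘ t, (Multiset.cons_le_cons_iff _).2 ht, by simp⟩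
    · obtain ⟨t, ht, rfl⟩ := ih u ((Multiset.le_cons_of_notMem hu).1 h)
      exact ⟨t, ht.trans (Multiset.le_cons_self _ _), rfl⟩

lemma aux_sorted {N : Type*} [Fintype N] [DecidableEq N] {W : Matrix N N ℂ}
    (hW : W.IsHermitian) (h3 : 3 ≤ Fintype.card N) :
    ∃ e : Fin 3 → N, Function.Injective e ∧
      ((sortedEigs hW).drop (Fintype.card N - 3)).sum = ∑ r, hW.eigenvalues (e r) := by
  have hle : (((sortedEigs hW).drop (Fintype.card N - 3) : List ℝ) : Multiset ℝ) ≤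
      Finset.univ.val.map hW.eigenvalues := by
    have h : ((sortedEigs hW : List ℝ) : Multiset ℝ) = Finset.univ.val.map hW.eigenvalues :=
      Multiset.sort_eq _ _
    rw [← h]
    exact Multiset.coe_le.2 (List.drop_sublist _ _).subperm
  have hlen : (sortedEigs hW).length = Fintype.card N := by
    simp [sortedEigs]
  obtain ⟨t, ht, hm⟩ := aux_le_map _ _ _ hle
  have hnd : t.Nodup := Multiset.nodup_of_le ht Finset.univ.nodup
  have hc : Fintype.card (⟨t, hnd⟩ : Finset N) = 3 := by
    have := congrArg Multiset.card hm
    rw [Multiset.card_map, Multiset.coe_card, List.length_drop, hlen] at this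
    rw [Fintype.card_coe]
    change Multiset.card t = 3
    omega
  let E := (Fintype.equivFinOfCardEq hc).symm
  refine ⟨fun r => (E r : N), fun a b hab => E.injective (Subtype.ext hab), ?_⟩
  have h1 : ((sortedEigs hW).drop (Fintype.card N - 3)).sum =
      ∑ i ∈ (⟨t, hnd⟩ : Finset N), hW.eigenvalues i := by
    rw [← Multiset.sum_coe, ← hm]; rfl
  rw [h1, ← Finset.sum_coe_sort]
  exact (Equiv.sum_comp E (fun i => hW.eigenvalues i)).symm

lemma aux_part1 {m n : ℕ} (h3 : 3 ≤ m * n) {W : Matrix (Fin m × Fin n) (Fin m × Fin n) ℂ}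
    (hH : W.IsHermitian) (ht : W.trace = 1) (hd : Decomposable W) :
    -1 ≤ ((sortedEigs hH).drop (m * n - 3)).sum := by
  have hc : Fintype.card (Fin m × Fin n) = m * n := by simp
  obtain ⟨e, he, hs⟩ := aux_sorted hH (by rw [hc]; exact h3)
  rw [hc] at hs
  rw [hs]
  have := aux_decomp hd ht (fun r => hH.eigenvectorBasis (e r))
    (hH.eigenvectorBasis.orthonormal.comp e he)
  refine this.trans (le_of_eq (Finset.sum_congr rfl fun r _ => ?_))
  rw [hH.mulVec_eigenvectorBasis, dotProduct_smul, dotProduct_comm,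
    ← EuclideanSpace.inner_eq_star_dotProduct, inner_self_eq_norm_sq_to_K,
    hH.eigenvectorBasis.orthonormal.1]
  simp

lemma aux_list (L : List ℝ) (hL : L.Pairwise (· ≥ ·)) (c : ℝ) (k : ℕ)
    (h : k ≤ L.countP (fun x => x ≤ c)) (hk : k ≤ L.length) :
    ∀ x ∈ L.drop (L.length - k), x ≤ c := by
  intro x hx
  by_contra hxc
  push Not at hxc
  rw [← List.take_append_drop (L.length - k) L, List.pairwise_append] at hL
  have h1 : (L.take (L.length - k)).countP (fun x => x ≤ c) = 0 := by
    rw [List.countP_eq_zero]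
    intro y hy
    have := hL.2.2 y hy x hx
    simp
    linarith
  have h2 : (L.drop (L.length - k)).countP (fun x => x ≤ c) < (L.drop (L.length - k)).length := by
    refine lt_of_le_of_ne List.countP_le_length fun heq => ?_
    rw [List.countP_eq_length] at heq
    have := heq x hx
    simp at this
    linarith
  have h4 : L.countP (fun x => x ≤ c) = (L.take (L.length - k)).countP (fun x => x ≤ c) +
      (L.drop (L.length - k)).countP (fun x => x ≤ c) := by
    rw [← List.countP_append, List.take_append_drop]
  rw [List.length_drop] at h2
  omega

lemma aux_upper {N : Type*} [Fintype N] [DecidableEq N] {W : Matrix N N ℂ}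
    (hW : W.IsHermitian) (h3 : 3 ≤ Fintype.card N) (c : ℝ) (x : Fin 3 → EuclideanSpace ℂ N)
    (hx : Orthonormal ℂ x) (hWx : ∀ r, W.mulVec (x r).ofLp = (c : ℂ) • (x r).ofLp) :
    ((sortedEigs hW).drop (Fintype.card N - 3)).sum ≤ 3 * c := by
  have hlen : (sortedEigs hW).length = Fintype.card N := by
    simp [sortedEigs]
  -- eigenvectors with other eigenvalue are orthogonal
  have horth : ∀ r i, hW.eigenvalues i ≠ c → inner ℂ (x r) (hW.eigenvectorBasis i) = 0 := by
    intro r i hi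
    set b := (hW.eigenvectorBasis i).ofLp
    have e1 : star (x r).ofLp ⬝ᵥ W.mulVec b = (hW.eigenvalues i : ℂ) * (star (x r).ofLp ⬝ᵥ b) := by
      rw [hW.mulVec_eigenvectorBasis, dotProduct_smul]; rfl
    have e2 : star (x r).ofLp ⬝ᵥ W.mulVec b = (c : ℂ) * (star (x r).ofLp ⬝ᵥ b) := by
      have : star (x r).ofLp ᵥ* W = star (W *ᵥ (x r).ofLp) := by
        rw [Matrix.star_mulVec, hW.eq]
      rw [Matrix.dotProduct_mulVec, this, hWx, star_smul, smul_dotProduct]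
      simp
    rw [EuclideanSpace.inner_eq_star_dotProduct, dotProduct_comm]
    have : ((hW.eigenvalues i : ℂ) - c) * (star (x r).ofLp ⬝ᵥ b) = 0 := by
      rw [sub_mul, ← e1, ← e2, sub_self]
    rcases mul_eq_zero.1 this with h | h
    · exact absurd (by exact_mod_cast sub_eq_zero.1 h) hi
    · exact h
  have hcard : 3 ≤ (Finset.univ.filter fun i => hW.eigenvalues i ≤ c).card := by
    have e1 : ∀ r, ∑ i, ‖inner ℂ (x r) (hW.eigenvectorBasis i)‖ ^ 2 = 1 := by
      intro r; rw [hW.eigenvectorBasis.sum_sq_norm_inner_left, hx.1]; simp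
    have e2 : ∀ i, ∑ r, ‖inner ℂ (x r) (hW.eigenvectorBasis i)‖ ^ 2 ≤
        if hW.eigenvalues i ≤ c then 1 else 0 := by
      intro i
      split_ifs with h
      · have := hx.sum_inner_products_le (s := Finset.univ) (hW.eigenvectorBasis i)
        rw [hW.eigenvectorBasis.orthonormal.1] at this
        simpa using this
      · refine le_of_eq (Finset.sum_eq_zero fun r _ => ?_)
        rw [horth r i (fun h' => h h'.le)]; simp
    have h1 := Finset.sum_le_sum fun i (_ : i ∈ Finset.univ) => e2 i
    rw [Finset.sum_comm] at h1
    simp only [e1] at h1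
    rw [Finset.sum_boole] at h1
    simp at h1
    exact_mod_cast h1
  have hcount : 3 ≤ (sortedEigs hW).countP (fun y => y ≤ c) := by
    have h : ((sortedEigs hW : List ℝ) : Multiset ℝ) = Finset.univ.val.map hW.eigenvalues :=
      Multiset.sort_eq _ _
    rw [← Multiset.coe_countP, h, Multiset.countP_map]
    exact hcard
  have hall := aux_list (sortedEigs hW) (Multiset.pairwise_sort _ _) c 3 hcount (by rw [hlen]; exact h3)
  rw [hlen] at hall
  have := List.sum_le_card_nsmul _ c hall
  rw [List.length_drop, hlen, show Fintype.card N - (Fintype.card N - 3) = 3 by omega] at this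
  simpa using this

lemma aux_part2 {m n : ℕ} (hm : 3 ≤ m) (hmn : m ≤ n)
    (φ : Fin m × Fin n → ℂ)
    (hφ : φ = fun p =>
      if (p.1 : ℕ) = (p.2 : ℕ) ∧ (p.1 : ℕ) < 3 then (((Real.sqrt 3)⁻¹ : ℝ) : ℂ)
      else 0) :
    ∃ x : Fin 3 → EuclideanSpace ℂ (Fin m × Fin n), Orthonormal ℂ x ∧
      ∀ r, (ptrans (Matrix.vecMulVec φ (star φ))).mulVec (x r).ofLp
        = (((-1 / 3 : ℝ) : ℝ) : ℂ) • (x r).ofLp := by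
  let i : Fin 3 → Fin m := fun a => ⟨a, by omega⟩
  let k : Fin 3 → Fin n := fun a => ⟨a, by omega⟩
  have hT : ∀ a b, (ptrans (Matrix.vecMulVec φ (star φ))).mulVec (Pi.single (i a, k b) 1) =
      (1 / 3 : ℂ) • Pi.single (i b, k a) 1 := by
    intro a b
    rw [Matrix.mulVec_single_one]
    ext ⟨p, q⟩
    have h3 : ((Real.sqrt 3 : ℝ) : ℂ)⁻¹ * ((Real.sqrt 3 : ℝ) : ℂ)⁻¹ = 1 / 3 := by
      rw [← mul_inv, ← Complex.ofReal_mul, Real.mul_self_sqrt (by norm_num)]; norm_num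
    simp only [Matrix.col_apply, ptrans, Matrix.vecMulVec_apply, Pi.star_apply, hφ, Pi.smul_apply,
      Pi.single_apply, Prod.mk.injEq, Fin.ext_iff, i, k, smul_eq_mul]
    have ha := a.2
    have hb := b.2
    by_cases h1 : (p : ℕ) = b
    · by_cases h2 : (q : ℕ) = a
      · simp [h1, h2, h3]
      · simp [h1, h2, Ne.symm h2]
    · simp [h1]
  let u : Fin 3 → Fin 3 := ![0, 0, 1]
  let w : Fin 3 → Fin 3 := ![1, 2, 2]
  refine ⟨fun r => (((Real.sqrt 2)⁻¹ : ℝ) : ℂ) • (EuclideanSpace.single (i (u r), k (w r)) 1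
    - EuclideanSpace.single (i (w r), k (u r)) 1), ?_, ?_⟩
  · have h2 : ((Real.sqrt 2 : ℝ) : ℂ)⁻¹ * (((Real.sqrt 2 : ℝ) : ℂ)⁻¹ * 2) = 1 := by
      rw [← mul_assoc, ← mul_inv, ← Complex.ofReal_mul, Real.mul_self_sqrt (by norm_num)]; norm_num
    have h2' : ((Real.sqrt 2 : ℝ) : ℂ)⁻¹ * (((Real.sqrt 2 : ℝ) : ℂ)⁻¹ * (1 + 1)) = 1 := by
      rw [one_add_one_eq_two, h2]
    rw [orthonormal_iff_ite]
    intro r s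
    rw [inner_smul_left, inner_smul_right, inner_sub_left, inner_sub_right, inner_sub_right]
    simp only [EuclideanSpace.inner_single_left, PiLp.single_apply]
    fin_cases r <;> fin_cases s <;> simp [u, w, i, k, Fin.ext_iff, h2']
  · intro r
    have : (((((Real.sqrt 2)⁻¹ : ℝ) : ℂ) • (EuclideanSpace.single (i (u r), k (w r)) (1 : ℂ)
      - EuclideanSpace.single (i (w r), k (u r)) 1) : EuclideanSpace ℂ (Fin m × Fin n)).ofLp) =
      (((Real.sqrt 2)⁻¹ : ℝ) : ℂ) • (Pi.single (i (u r), k (w r)) (1 : ℂ)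
      - Pi.single (i (w r), k (u r)) 1) := by
      simp
    rw [this, Matrix.mulVec_smul, Matrix.mulVec_sub, hT, hT]
    ext p
    simp only [Pi.smul_apply, Pi.sub_apply, smul_eq_mul]
    push_cast
    ring

lemma aux_bp {m n : ℕ} (φ : Fin m × Fin n → ℂ) :
    BlockPositive (ptrans (Matrix.vecMulVec φ (star φ))) := by
  refine ⟨?_, ?_⟩
  · ext p q
    simp [ptrans, Matrix.vecMulVec_apply, mul_comm]
  · intro a b
    set z : ℂ := ∑ j, ∑ k, φ (j, k) * (a j * star (b k)) with hz
    have e : star (prodVec a b) ⬝ᵥ (ptrans (Matrix.vecMulVec φ (star φ))).mulVec (prodVec a b)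
        = z * star z := by
      simp only [hz, star_sum, dotProduct, Matrix.mulVec, Fintype.sum_prod_type, Finset.mul_sum,
        Finset.sum_mul, ptrans, Matrix.vecMulVec_apply, Pi.star_apply, prodVec, star_mul', star_star]
      -- left: i k j l
      refine Finset.sum_congr rfl fun i _ => ?_
      conv_rhs => rw [Finset.sum_comm]
      rw [Finset.sum_comm]
      refine Finset.sum_congr rfl fun j _ => ?_
      conv_rhs => rw [Finset.sum_comm]
      refine Finset.sum_congr rfl fun k _ => Finset.sum_congr rfl fun l _ => ?_
      ring
    rw [e]
    have : z * star z = ((Complex.normSq z : ℝ) : ℂ) := Complex.mul_conj z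
    rw [this, Complex.ofReal_re, Complex.ofReal_im]
    exact ⟨Complex.normSq_nonneg z, rfl⟩

lemma aux_trace {m n : ℕ} (hm : 3 ≤ m) (hmn : m ≤ n)
    (φ : Fin m × Fin n → ℂ)
    (hφ : φ = fun p =>
      if (p.1 : ℕ) = (p.2 : ℕ) ∧ (p.1 : ℕ) < 3 then (((Real.sqrt 3)⁻¹ : ℝ) : ℂ)
      else 0) :
    (ptrans (Matrix.vecMulVec φ (star φ))).trace = 1 := by
  have h3 : ((Real.sqrt 3 : ℝ) : ℂ)⁻¹ * ((Real.sqrt 3 : ℝ) : ℂ)⁻¹ = 1 / 3 := by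
    rw [← mul_inv, ← Complex.ofReal_mul, Real.mul_self_sqrt (by norm_num)]; norm_num
  have h1 : ∀ i : Fin m, ∑ k : Fin n, φ (i, k) * star (φ (i, k)) =
      if (i : ℕ) < 3 then (1 / 3 : ℂ) else 0 := by
    intro i
    have hin : (i : ℕ) < n := lt_of_lt_of_le i.2 hmn
    rw [Finset.sum_eq_single (⟨i, hin⟩ : Fin n)]
    · by_cases h : (i : ℕ) < 3
      · simp [hφ, h, h3]
      · simp [hφ, h]
    · intro k _ hk
      have : (i : ℕ) ≠ k := fun h => hk (Fin.ext h.symm)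
      simp [hφ, this]
    · simp
  have h2 : (ptrans (Matrix.vecMulVec φ (star φ))).trace =
      ∑ i, ∑ k, φ (i, k) * star (φ (i, k)) := by
    rw [← Fintype.sum_prod_type']
    rfl
  rw [h2]
  simp_rw [h1]
  obtain ⟨d, rfl⟩ := Nat.exists_eq_add_of_le hm
  rw [Fin.sum_univ_add]
  simp

lemma aux_dec {m n : ℕ} (φ : Fin m × Fin n → ℂ) :
    Decomposable (ptrans (Matrix.vecMulVec φ (star φ))) :=
  ⟨0, Matrix.vecMulVec φ (star φ), Matrix.PosSemidef.zero,
    Matrix.posSemidef_vecMulVec_self_star φ, by simp⟩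

/-- For any normalized `m × n` decomposable entanglement witness (`3 ≤ m ≤ n`),
the sum of the three smallest eigenvalues is at least `-1`, and this bound is
attained by the partial transpose of the two-qutrit maximally entangled state
`φ = (1/√3)(e₁⊗f₁ + e₂⊗f₂ + e₃⊗f₃)`. -/
theorem stmt_15 {m n : ℕ} (hm : 3 ≤ m) (hmn : m ≤ n)
    (φ : Fin m × Fin n → ℂ)
    (hφ : φ = fun p =>
      if (p.1 : ℕ) = (p.2 : ℕ) ∧ (p.1 : ℕ) < 3 then (((Real.sqrt 3)⁻¹ : ℝ) : ℂ)
      else 0) :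
    (∀ (W : Matrix (Fin m × Fin n) (Fin m × Fin n) ℂ)
      (hBP : BlockPositive W), ¬ W.PosSemidef → W.trace = 1 → Decomposable W →
      -1 ≤ ((sortedEigs hBP.1).drop (m * n - 3)).sum) ∧
    (∃ hBP : BlockPositive (ptrans (Matrix.vecMulVec φ (star φ))),
      ¬ (ptrans (Matrix.vecMulVec φ (star φ))).PosSemidef ∧
      (ptrans (Matrix.vecMulVec φ (star φ))).trace = 1 ∧
      Decomposable (ptrans (Matrix.vecMulVec φ (star φ))) ∧
      ((sortedEigs hBP.1).drop (m * n - 3)).sum = -1) := by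
  have h3 : 3 ≤ m * n := by nlinarith
  refine ⟨fun W hBP _ ht hd => aux_part1 h3 hBP.1 ht hd, aux_bp φ, ?_, ?_, ?_, ?_⟩
  · intro hP
    obtain ⟨x, hx, hTx⟩ := aux_part2 hm hmn φ hφ
    have h := (Complex.le_def.1 (hP.dotProduct_mulVec_nonneg (x 0).ofLp)).1
    rw [hTx, dotProduct_smul, dotProduct_comm, ← EuclideanSpace.inner_eq_star_dotProduct,
      inner_self_eq_norm_sq_to_K, hx.1] at h
    norm_num at h
  · exact aux_trace hm hmn φ hφ
  · exact aux_dec φ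
  · refine le_antisymm ?_ (aux_part1 h3 _ (aux_trace hm hmn φ hφ) (aux_dec φ))
    obtain ⟨x, hx, hTx⟩ := aux_part2 hm hmn φ hφ
    have hc : Fintype.card (Fin m × Fin n) = m * n := by simp
    have := aux_upper (aux_bp φ).1 (by rw [hc]; exact h3) _ x hx hTx
    rw [hc] at this
    linarith

end
end
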